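/- Let Γ be a finite tree. Let Out⁰(A_Γ) be the subgroup of Out(A_Γ) generated by the classes of inversions, partial conjugations, and transvections. Then Out⁰(A_Γ) is virtually torsion-free: it has a torsion-free subgroup of finite index. -/

import Mathlib

/-- The relators of a right-angled Artin group: commutators of adjacent generators. -/
def raagRels {V : Type*} (Γ : SimpleGraph V) : Set (FreeGroup V) :=
  {r | ∃ v w : V, Γ.Adj v w ∧
    r = FreeGroup.of v * FreeGroup.of w * (FreeGroup.of v)⁻¹ * (FreeGroup.of w)⁻¹}

/-- The right-angled Artin group of a simple graph. -/
abbrev RAAG {V : Type*} (Γ : SimpleGraph V) : Type _ := PresentedGroup (raagRels Γ)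

/-- The generator of `RAAG Γ` corresponding to a vertex. -/
def raagGen {V : Type*} (Γ : SimpleGraph V) (v : V) : RAAG Γ := PresentedGroup.of v

instance innerAutNormal (G : Type*) [Group G] :
    ((MulAut.conj : G →* MulAut G).range).Normal := by
  constructor
  intro x hx φ
  obtain ⟨g, rfl⟩ := hx
  refine ⟨φ g, ?_⟩
  ext y
  simp [MulAut.conj]

abbrev OutG (G : Type*) [Group G] : Type _ :=
  MulAut G ⧸ ((MulAut.conj : G →* MulAut G).range)

def outMk (G : Type*) [Group G] : MulAut G →* OutG G :=
  QuotientGroup.mk' _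

/-- `v` is a leaf: it has exactly one neighbor. -/
def IsLeaf {V : Type*} (Γ : SimpleGraph V) (v : V) : Prop :=
  (Γ.neighborSet v).ncard = 1

/-- The number of leaves. -/
noncomputable def numLeaves {V : Type*} (Γ : SimpleGraph V) : ℕ :=
  {v | IsLeaf Γ v}.ncard

/-- A subgraph has no separating vertex: deleting any of its vertices leaves it connected. -/
def NoCutVertex {V : Type*} {Γ : SimpleGraph V} (H : Γ.Subgraph) : Prop :=
  ∀ v ∈ H.verts, (H.deleteVerts {v}).Connected

/-- A piece (block) of `Γ`: a maximal connected subgraph with at least one edge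
having no separating vertex (a single edge counts as a piece). -/
def IsPiece {V : Type*} (Γ : SimpleGraph V) (H : Γ.Subgraph) : Prop :=
  H.Connected ∧ H.edgeSet.Nonempty ∧ NoCutVertex H ∧
    ∀ H' : Γ.Subgraph, H'.Connected → H'.edgeSet.Nonempty → NoCutVertex H' →
      H ≤ H' → H' = H

/-- The number of pieces of `Γ`. -/
noncomputable def numPieces {V : Type*} (Γ : SimpleGraph V) : ℕ :=
  Nat.card {H : Γ.Subgraph // IsPiece Γ H}

/-- `u` and `w` are connected by a walk in `Γ` avoiding the vertex `v`
(i.e. they lie in the same connected component of `Γ ∖ {v}`). -/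
def ReachAvoid {V : Type*} (Γ : SimpleGraph V) (v u w : V) : Prop :=
  ∃ p : Γ.Walk u w, v ∉ p.support

/-- There is an injective homomorphism from the free abelian group of rank `r` into `G`. -/
def HasFreeAbelianSubgroupOfRank (G : Type*) [Group G] (r : ℕ) : Prop :=
  ∃ f : Multiplicative (Fin r →₀ ℤ) →* G, Function.Injective f

/-- `ψ` is an inversion: it sends one generator `v` to `v⁻¹` and fixes all
other generators. -/
def IsInversion {V : Type*} (Γ : SimpleGraph V) (ψ : MulAut (RAAG Γ)) : Prop :=
  ∃ v : V, ψ (raagGen Γ v) = (raagGen Γ v)⁻¹ ∧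
    ∀ w : V, w ≠ v → ψ (raagGen Γ w) = raagGen Γ w

/-- `ψ` is a partial conjugation: for some vertex `v` and some union `C` of
connected components of `Γ ∖ {v}`, it sends each generator `u ∈ C` to
`v u v⁻¹` and fixes all other generators. -/
def IsPartialConj {V : Type*} (Γ : SimpleGraph V) (ψ : MulAut (RAAG Γ)) : Prop :=
  ∃ (v : V) (C : Set V), v ∉ C ∧
    (∀ u ∈ C, ∀ u' : V, u' ≠ v → ReachAvoid Γ v u u' → u' ∈ C) ∧
    (∀ u ∈ C, ψ (raagGen Γ u) = raagGen Γ v * raagGen Γ u * (raagGen Γ v)⁻¹) ∧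
    (∀ u : V, u ∉ C → ψ (raagGen Γ u) = raagGen Γ u)

/-- `ψ` is a transvection: for some vertices `u ≠ v` with `lk(u) ⊆ st(v)`, it
sends `u ↦ u·v` and fixes all other generators. -/
def IsTransvection {V : Type*} (Γ : SimpleGraph V) (ψ : MulAut (RAAG Γ)) : Prop :=
  ∃ u v : V, u ≠ v ∧ Γ.neighborSet u ⊆ insert v (Γ.neighborSet v) ∧
    ψ (raagGen Γ u) = raagGen Γ u * raagGen Γ v ∧
    ∀ w : V, w ≠ u → ψ (raagGen Γ w) = raagGen Γ w

/-- The subgroup `Out⁰(A_Γ)` of `Out(A_Γ)` generated by the classes of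
inversions, partial conjugations and transvections. -/
noncomputable def OutZero {V : Type*} (Γ : SimpleGraph V) :
    Subgroup (OutG (RAAG Γ)) :=
  Subgroup.closure (outMk (RAAG Γ) ''
    {ψ | IsInversion Γ ψ ∨ IsPartialConj Γ ψ ∨ IsTransvection Γ ψ})

namespace RaagOut

section Trace

variable {V : Type*} (Γ : SimpleGraph V)

/-- An elementary commutation of two adjacent letters in a word. -/
inductive Swap : List V → List V → Prop
  | intro (p q : List V) {a b : V} (h : Γ.Adj a b) : Swap (p ++ a :: b :: q) (p ++ b :: a :: q)

variable {Γ} in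
theorem Swap.append {l l' : List V} (h : Swap Γ l l') (p q : List V) :
    Swap Γ (p ++ l ++ q) (p ++ l' ++ q) := by
  obtain ⟨r, s, hab⟩ := h
  simpa using Swap.intro (p ++ r) (s ++ q) hab

variable {Γ} in
theorem eqvGen_swap_append {l l' : List V} (h : Relation.EqvGen (Swap Γ) l l') (p q : List V) :
    Relation.EqvGen (Swap Γ) (p ++ l ++ q) (p ++ l' ++ q) := by
  induction h with
  | rel _ _ h => exact .rel _ _ (h.append p q)
  | refl _ => exact .refl _
  | symm _ _ _ ih => exact .symm _ _ ih
  | trans _ _ _ _ _ ih₁ ih₂ => exact .trans _ _ _ ih₁ ih₂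

/-- The congruence on the free monoid generated by commutations of adjacent letters. -/
def traceCon : Con (FreeMonoid V) where
  r x y := Relation.EqvGen (Swap Γ) x.toList y.toList
  iseqv := (Relation.EqvGen.is_equivalence (Swap Γ)).comap FreeMonoid.toList
  mul' {w x y z} h₁ h₂ := by
    have e₁ := eqvGen_swap_append h₁ [] y.toList
    have e₂ := eqvGen_swap_append h₂ x.toList []
    simp only [List.nil_append, List.append_nil] at e₁ e₂
    simpa using e₁.trans _ _ _ e₂

/-- The trace monoid (partially commutative free monoid) of a graph. -/
abbrev Trace : Type _ := (traceCon Γ).Quotient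

/-- The class of a word in the trace monoid. -/
def word (l : List V) : Trace Γ := ((FreeMonoid.ofList l : FreeMonoid V) : (traceCon Γ).Quotient)

/-- The class of a letter in the trace monoid. -/
abbrev letter (v : V) : Trace Γ := word Γ [v]

theorem word_nil : word Γ [] = 1 := rfl

theorem word_append (l l' : List V) : word Γ (l ++ l') = word Γ l * word Γ l' := rfl

theorem word_cons (v : V) (l : List V) : word Γ (v :: l) = letter Γ v * word Γ l := rfl

theorem word_eq_iff {l l' : List V} :
    word Γ l = word Γ l' ↔ Relation.EqvGen (Swap Γ) l l' :=
  (traceCon Γ).eq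

theorem word_surjective : Function.Surjective (word Γ) := fun m => by
  induction m using Con.induction_on with
  | _ x => exact ⟨x.toList, rfl⟩

theorem letter_commute {a b : V} (h : Γ.Adj a b) : Commute (letter Γ a) (letter Γ b) :=
  (word_eq_iff Γ).2 (.rel _ _ (Swap.intro [] [] h))

variable {Γ} in
theorem prod_map_eq_of_eqvGen {M : Type*} [Monoid M] {f : V → M}
    (hf : ∀ a b, Γ.Adj a b → Commute (f a) (f b)) {l l' : List V}
    (h : Relation.EqvGen (Swap Γ) l l') : (l.map f).prod = (l'.map f).prod := by
  induction h with
  | rel _ _ h =>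
    obtain ⟨p, q, hab⟩ := h
    simp only [List.map_append, List.map_cons, List.prod_append, List.prod_cons]
    rw [← mul_assoc (f _), (hf _ _ hab).eq, mul_assoc (f _)]
  | refl _ => rfl
  | symm _ _ _ ih => exact ih.symm
  | trans _ _ _ _ _ ih₁ ih₂ => exact ih₁.trans ih₂

/-- The universal property of the trace monoid. -/
def traceLift {M : Type*} [Monoid M] (f : V → M)
    (hf : ∀ a b, Γ.Adj a b → Commute (f a) (f b)) : Trace Γ →* M :=
  (traceCon Γ).lift (FreeMonoid.lift f) fun x y h => by
    rw [Con.ker_rel, FreeMonoid.lift_apply, FreeMonoid.lift_apply]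
    exact prod_map_eq_of_eqvGen hf h

theorem traceLift_word {M : Type*} [Monoid M] (f : V → M)
    (hf : ∀ a b, Γ.Adj a b → Commute (f a) (f b)) (l : List V) :
    traceLift Γ f hf (word Γ l) = (l.map f).prod :=
  FreeMonoid.lift_apply f (FreeMonoid.ofList l)

theorem eqvGen_swap_erase [DecidableEq V] (v : V) {l l' : List V}
    (h : Relation.EqvGen (Swap Γ) l l') :
    Relation.EqvGen (Swap Γ) (l.erase v) (l'.erase v) := by
  induction h with
  | rel _ _ h =>
    obtain ⟨p, q, hab⟩ := h
    rename_i a b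
    have hne := hab.ne
    by_cases hp : v ∈ p
    · rw [List.erase_append_left _ hp, List.erase_append_left _ hp]
      exact .rel _ _ (Swap.intro _ _ hab)
    · rw [List.erase_append_right _ hp, List.erase_append_right _ hp]
      by_cases ha : a = v
      · subst ha
        simp [hne.symm, Relation.EqvGen.refl]
      · by_cases hb : b = v
        · subst hb
          simp [hne, Relation.EqvGen.refl]
        · simp only [List.erase_cons, beq_iff_eq, ha, hb, if_false]
          exact .rel _ _ (Swap.intro _ _ hab)
  | refl _ => exact .refl _
  | symm _ _ _ ih => exact .symm _ _ ih
  | trans _ _ _ _ _ ih₁ ih₂ => exact .trans _ _ _ ih₁ ih₂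

theorem letter_mul_left_cancel (v : V) {m m' : Trace Γ}
    (h : letter Γ v * m = letter Γ v * m') : m = m' := by
  classical
  obtain ⟨l, rfl⟩ := word_surjective Γ m
  obtain ⟨l', rfl⟩ := word_surjective Γ m'
  rw [← word_cons, ← word_cons, word_eq_iff] at h
  simpa [word_eq_iff] using eqvGen_swap_erase Γ v h

theorem letter_pow_mul_left_cancel (v : V) (j : ℕ) {m m' : Trace Γ}
    (h : letter Γ v ^ j * m = letter Γ v ^ j * m') : m = m' := by
  induction j with
  | zero => simpa using h
  | succ j ih =>
    rw [pow_succ', mul_assoc, mul_assoc] at h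
    exact ih (letter_mul_left_cancel Γ v h)

/-- The closed star of a vertex. -/
def star (v : V) : Set V := {a | a = v ∨ Γ.Adj v a}

open Classical in
/-- Deletion of the letters other than `v` and `a`, when these do not commute. -/
noncomputable def pairProj (v a : V) (h : ¬ Γ.Adj v a) : Trace Γ →* FreeMonoid V :=
  traceLift Γ (fun x => if x = v ∨ x = a then FreeMonoid.of x else 1) (by
    intro x y hxy
    by_cases hx : x = v ∨ x = a
    · by_cases hy : y = v ∨ y = a
      · rcases hx with rfl | rfl <;> rcases hy with rfl | rfl
        · exact Commute.refl _
        · exact absurd hxy h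
        · exact absurd hxy.symm h
        · exact Commute.refl _
      · simp [hy]
    · simp [hx])

open Classical in
theorem pairProj_word (v a : V) (h : ¬ Γ.Adj v a) (l : List V) :
    (pairProj Γ v a h (word Γ l)).toList = l.filter (fun x => x = v ∨ x = a) := by
  induction l with
  | nil => rfl
  | cons x l ih =>
    rw [word_cons, map_mul, FreeMonoid.toList_mul, ih, List.filter_cons, pairProj, traceLift_word]
    by_cases hx : x = v ∨ x = a <;> simp [hx]

theorem subset_star_of_pow_mul_eq {v : V} {l : List V} {m : Trace Γ}
    (h : letter Γ v ^ (l.length + 1) * word Γ l = m * letter Γ v ^ (l.length + 1)) :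
    ∀ a ∈ l, a ∈ star Γ v := by
  classical
  intro a ha
  by_contra hS
  simp only [star, Set.mem_ofPred_eq, not_or] at hS
  have e := congrArg (fun x => (pairProj Γ v a hS.2 x).toList) h
  have hv : pairProj Γ v a hS.2 (letter Γ v) = FreeMonoid.of v := by
    simp [pairProj, traceLift_word]
  have hpow : ∀ j, (FreeMonoid.of v ^ j).toList = List.replicate j v := by
    intro j
    induction j with
    | zero => rfl
    | succ j ih => rw [pow_succ', FreeMonoid.toList_mul, ih]; rfl
  simp only [map_mul, map_pow, hv, FreeMonoid.toList_mul, hpow, pairProj_word] at e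
  set f := l.filter (fun x => x = v ∨ x = a) with hf
  have hfl : f.length ≤ l.length := List.length_filter_le _ _
  have haf : a ∈ f := by simp [hf, ha]
  have hsuf : f <:+ List.replicate (l.length + 1) v :=
    List.suffix_of_suffix_length_le (l₃ := List.replicate (l.length + 1) v ++ f)
      (List.suffix_append _ _) (e ▸ List.suffix_append _ _) (by simp; omega)
  exact hS.1 (List.eq_of_mem_replicate (hsuf.subset haf))

end Trace

end RaagOut

namespace RaagOut

open PowerSeries

section Algebra

variable {V : Type*} (Γ : SimpleGraph V)

/-- The rational trace algebra of a graph. -/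
abbrev TraceAlg : Type _ := MonoidAlgebra ℚ (Trace Γ)

/-- The generator of the trace algebra corresponding to a vertex. -/
noncomputable def var (v : V) : TraceAlg Γ := MonoidAlgebra.single (letter Γ v) 1

theorem var_commute {a b : V} (h : Γ.Adj a b) : Commute (var Γ a) (var Γ b) :=
  MonoidAlgebra.single_commute_single (letter_commute Γ h) (Commute.refl _)

theorem support_subset_of_commute {c : TraceAlg Γ} {v : V} (h : Commute (var Γ v) c)
    {m : Trace Γ} (hm : m ∈ c.coeff.support) :
    ∃ l, word Γ l = m ∧ ∀ a ∈ l, a ∈ star Γ v := by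
  obtain ⟨l, rfl⟩ := word_surjective Γ m
  refine ⟨l, rfl, ?_⟩
  have hpow := (h.pow_left (l.length + 1)).eq
  rw [var, MonoidAlgebra.single_pow, one_pow] at hpow
  have e₁ : (MonoidAlgebra.single (letter Γ v ^ (l.length + 1)) 1 * c).coeff
      (letter Γ v ^ (l.length + 1) * word Γ l) = 1 * c.coeff (word Γ l) :=
    MonoidAlgebra.coeff_single_mul_eq_mul_coeff _ fun m' _ =>
      ⟨fun e => letter_pow_mul_left_cancel Γ v _ e, fun e => by rw [e]⟩
  rw [hpow] at e₁
  have hne : 1 * c.coeff (word Γ l) ≠ 0 := by simpa using hm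
  by_contra hcon
  refine hne (e₁.symm.trans (MonoidAlgebra.coeff_mul_single_of_forall_mul_ne _ _ fun d hd => ?_))
  exact hcon (subset_star_of_pow_mul_eq Γ hd.symm)

open Classical in
/-- The monoid map to the trace algebra killing the letters outside `S`. -/
noncomputable def varRetract (S : Set V) : Trace Γ →* TraceAlg Γ :=
  traceLift Γ (fun v => if v ∈ S then var Γ v else 0) (by
    intro x y hxy
    by_cases hx : x ∈ S <;> by_cases hy : y ∈ S <;> simp [hx, hy, var_commute Γ hxy])

open Classical in
theorem varRetract_letter (S : Set V) (v : V) :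
    varRetract Γ S (letter Γ v) = if v ∈ S then var Γ v else 0 := by
  simp [varRetract, traceLift_word]

theorem varRetract_word_of_subset {S : Set V} {l : List V} (h : ∀ a ∈ l, a ∈ S) :
    varRetract Γ S (word Γ l) = MonoidAlgebra.single (word Γ l) 1 := by
  induction l with
  | nil => exact map_one _
  | cons x l ih =>
    rw [word_cons, map_mul, ih fun a ha => h a (List.mem_cons_of_mem _ ha), varRetract_letter,
      if_pos (h x List.mem_cons_self), var, MonoidAlgebra.single_mul_single, one_mul]

/-- Retraction of the trace algebra killing the letters outside `S`. -/
noncomputable def algRetract (S : Set V) : TraceAlg Γ →ₐ[ℚ] TraceAlg Γ :=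
  MonoidAlgebra.lift ℚ _ _ (varRetract Γ S)

theorem algRetract_single (S : Set V) (m : Trace Γ) (r : ℚ) :
    algRetract Γ S (MonoidAlgebra.single m r) = r • varRetract Γ S m := by
  simp [algRetract, MonoidAlgebra.lift_single]

open Classical in
theorem algRetract_var (S : Set V) (v : V) :
    algRetract Γ S (var Γ v) = if v ∈ S then var Γ v else 0 := by
  rw [var, algRetract_single, one_smul, varRetract_letter, var]

theorem algRetract_star_of_commute {c : TraceAlg Γ} {v : V} (h : Commute (var Γ v) c) :
    algRetract Γ (star Γ v) c = c := by
  have hc : c = ∑ m ∈ c.coeff.support, MonoidAlgebra.single m (c.coeff m) := by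
    apply MonoidAlgebra.coeff_injective
    rw [MonoidAlgebra.coeff_sum]
    exact (Finsupp.sum_single c.coeff).symm
  conv_lhs => rw [hc, map_sum]
  conv_rhs => rw [hc]
  refine Finset.sum_congr rfl fun m hm => ?_
  obtain ⟨l, rfl, hl⟩ := support_subset_of_commute Γ h hm
  rw [algRetract_single, varRetract_word_of_subset Γ hl, MonoidAlgebra.smul_single, smul_eq_mul,
    mul_one]

theorem algRetract_algRetract_commute {S S' : Set V} {y : V}
    (h : ∀ x ∈ S, x ∈ S' → y = x ∨ Γ.Adj x y) (c : TraceAlg Γ) :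
    Commute (algRetract Γ S (algRetract Γ S' c)) (var Γ y) := by
  classical
  induction c using MonoidAlgebra.induction_on with
  | of m =>
    obtain ⟨l, rfl⟩ := word_surjective Γ m
    rw [MonoidAlgebra.of_apply, algRetract_single, one_smul]
    induction l with
    | nil => simp [word_nil]
    | cons x l ih =>
      rw [word_cons, map_mul, map_mul]
      refine Commute.mul_left ?_ ih
      rw [varRetract_letter]
      by_cases hx' : x ∈ S'
      · rw [if_pos hx', algRetract_var]
        by_cases hx : x ∈ S
        · rw [if_pos hx]
          rcases h x hx hx' with rfl | h
          · exact Commute.refl _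
          · exact var_commute Γ h
        · simp [hx]
      · simp [hx']
  | add a b ha hb => rw [map_add, map_add]; exact ha.add_left hb
  | smul r a ha =>
    rw [map_smul, map_smul]
    exact ha.smul_left r

end Algebra

section Congruence

variable {A : Type*} [Ring A]

/-- Congruence of power series modulo `X ^ N`. -/
def EqMod (N : ℕ) (F G : A⟦X⟧) : Prop := ∀ i < N, coeff i F = coeff i G

theorem EqMod.refl (N : ℕ) (F : A⟦X⟧) : EqMod N F F := fun _ _ => rfl

theorem EqMod.symm {N : ℕ} {F G : A⟦X⟧} (h : EqMod N F G) : EqMod N G F :=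
  fun i hi => (h i hi).symm

theorem EqMod.trans {N : ℕ} {F G H : A⟦X⟧} (h : EqMod N F G) (h' : EqMod N G H) : EqMod N F H :=
  fun i hi => (h i hi).trans (h' i hi)

theorem EqMod.mono {N M : ℕ} {F G : A⟦X⟧} (h : EqMod N F G) (hM : M ≤ N) : EqMod M F G :=
  fun i hi => h i (hi.trans_le hM)

theorem EqMod.mul {N : ℕ} {F G F' G' : A⟦X⟧} (h : EqMod N F G) (h' : EqMod N F' G') :
    EqMod N (F * F') (G * G') := by
  intro i hi
  rw [coeff_mul, coeff_mul]
  refine Finset.sum_congr rfl fun p hp => ?_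
  have := Finset.HasAntidiagonal.mem_antidiagonal.1 hp
  rw [h p.1 (by omega), h' p.2 (by omega)]

theorem EqMod.map {N : ℕ} {B : Type*} [Ring B] (f : A →+* B) {F G : A⟦X⟧} (h : EqMod N F G) :
    EqMod N (PowerSeries.map f F) (PowerSeries.map f G) := by
  intro i hi
  rw [coeff_map, coeff_map, h i hi]

theorem EqMod.mul_right_cancel {N : ℕ} {U : (A⟦X⟧)ˣ} {F G : A⟦X⟧}
    (h : EqMod N (F * (U : A⟦X⟧)) (G * (U : A⟦X⟧))) : EqMod N F G := by
  simpa [mul_assoc] using h.mul (EqMod.refl N (↑U⁻¹ : A⟦X⟧))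

theorem eq_of_forall_eqMod {F G : A⟦X⟧} (h : ∀ N, EqMod N F G) : F = G :=
  PowerSeries.ext fun n => h (n + 1) n (Nat.lt_succ_self n)

/-- A power series with constant coefficient `1`, as a unit. -/
noncomputable def unitOfConstOne (F : A⟦X⟧) (h : constantCoeff F = 1) : (A⟦X⟧)ˣ where
  val := F
  inv := invOfUnit F 1
  val_inv := mul_invOfUnit F 1 h
  inv_val := invOfUnit_mul F 1 h

/-- `1 + aX` as a unit of the ring of power series. -/
noncomputable def oneAddUnit (a : A) : (A⟦X⟧)ˣ := unitOfConstOne (1 + C a * X) (by simp)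

theorem oneAddUnit_val (a : A) : (oneAddUnit a : A⟦X⟧) = 1 + C a * X := rfl

theorem oneAddUnit_commute {a b : A} (h : Commute a b) :
    Commute (oneAddUnit a) (oneAddUnit b) := by
  apply Units.ext
  have hC : Commute (C a) (C b) := h.map C
  have h1 : Commute (C a * X) (C b * X) :=
    (hC.mul_right (commute_X _)).mul_left ((commute_X _).symm.mul_right (Commute.refl _))
  exact ((Commute.one_left _).add_left ((Commute.one_right _).add_right h1)).eq

theorem coeff_commute_of_eqMod {a : A} {F : A⟦X⟧} {N : ℕ}
    (h : EqMod N ((oneAddUnit a : A⟦X⟧) * F) (F * (oneAddUnit a : A⟦X⟧))) {i : ℕ} (hi : i + 1 < N) :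
    Commute a (coeff i F) := by
  have e := h (i + 1) hi
  rw [oneAddUnit_val, add_mul, mul_add, one_mul, mul_one, map_add, map_add, mul_assoc, X_mul,
    ← mul_assoc, ← mul_assoc, coeff_succ_mul_X, coeff_succ_mul_X, coeff_C_mul, coeff_mul_C] at e
  exact add_left_cancel e

theorem oneAddUnit_commute_of_coeff {a : A} {F : A⟦X⟧} (h : ∀ i, Commute (coeff i F) a) :
    Commute F (oneAddUnit a : A⟦X⟧) := by
  rw [oneAddUnit_val]
  refine (Commute.one_right _).add_right (Commute.mul_right ?_ (commute_X F))
  refine PowerSeries.ext fun i => ?_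
  rw [coeff_mul_C, coeff_C_mul, (h i).eq]

end Congruence

section Magnus

variable {V : Type*} (Γ : SimpleGraph V)

/-- A map to a group sending adjacent vertices to commuting elements extends to the RAAG. -/
def raagLift {G : Type*} [Group G] (f : V → G)
    (hf : ∀ a b, Γ.Adj a b → Commute (f a) (f b)) : RAAG Γ →* G :=
  PresentedGroup.toGroup (f := f) (by
    rintro r ⟨v, w, h, rfl⟩
    simp only [map_mul, map_inv, FreeGroup.lift_apply_of]
    rw [(hf v w h).eq, mul_inv_cancel_right, mul_inv_cancel])

theorem raagLift_gen {G : Type*} [Group G] (f : V → G)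
    (hf : ∀ a b, Γ.Adj a b → Commute (f a) (f b)) (v : V) :
    raagLift Γ f hf (raagGen Γ v) = f v :=
  PresentedGroup.toGroup.of _

theorem raagGen_commute {a b : V} (h : Γ.Adj a b) : Commute (raagGen Γ a) (raagGen Γ b) := by
  have e : PresentedGroup.mk (raagRels Γ)
      (FreeGroup.of a * FreeGroup.of b * (FreeGroup.of a)⁻¹ * (FreeGroup.of b)⁻¹) = 1 :=
    PresentedGroup.one_of_mem ⟨a, b, h, rfl⟩
  simp only [map_mul, map_inv] at e
  exact mul_inv_eq_iff_eq_mul.1 (mul_inv_eq_one.1 e)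

variable {Γ} in
theorem raag_hom_ext {M : Type*} [Monoid M] {f g : RAAG Γ →* M}
    (h : ∀ v, f (raagGen Γ v) = g (raagGen Γ v)) : f = g := by
  have h' : f.toHomUnits = g.toHomUnits := PresentedGroup.ext fun v => Units.ext (h v)
  ext x
  simpa using congrArg (fun k : RAAG Γ →* Mˣ => (k x : M)) h'

variable {Γ} in
theorem raag_mem_of_gen {H : Subgroup (RAAG Γ)} (h : ∀ v, raagGen Γ v ∈ H) (x : RAAG Γ) :
    x ∈ H :=
  PresentedGroup.generated_by _ H h x

/-- The Magnus representation of a RAAG in power series over the trace algebra. -/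
noncomputable def magnus : RAAG Γ →* ((TraceAlg Γ)⟦X⟧)ˣ :=
  raagLift Γ (fun v => oneAddUnit (var Γ v)) fun _ _ h => oneAddUnit_commute (var_commute Γ h)

theorem magnus_gen (v : V) : magnus Γ (raagGen Γ v) = oneAddUnit (var Γ v) :=
  raagLift_gen Γ _ _ v

theorem constantCoeff_magnus (x : RAAG Γ) : constantCoeff (magnus Γ x : (TraceAlg Γ)⟦X⟧) = 1 := by
  have h : ((constantCoeff : (TraceAlg Γ)⟦X⟧ →+* _) : (TraceAlg Γ)⟦X⟧ →* TraceAlg Γ).comp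
      ((Units.coeHom _).comp (magnus Γ)) = 1 :=
    raag_hom_ext fun v => by simp [magnus_gen, oneAddUnit_val]
  exact DFunLike.congr_fun h x

open Classical in
/-- Retraction of a RAAG killing the generators outside `S`. -/
noncomputable def raagRetract (S : Set V) : RAAG Γ →* RAAG Γ :=
  raagLift Γ (fun v => if v ∈ S then raagGen Γ v else 1) (by
    intro x y hxy
    by_cases hx : x ∈ S <;> by_cases hy : y ∈ S <;> simp [hx, hy, raagGen_commute Γ hxy])

open Classical in
theorem raagRetract_gen (S : Set V) (v : V) :
    raagRetract Γ S (raagGen Γ v) = if v ∈ S then raagGen Γ v else 1 :=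
  raagLift_gen Γ _ _ v

theorem map_algRetract_magnus (S : Set V) (x : RAAG Γ) :
    PowerSeries.map (algRetract Γ S : TraceAlg Γ →+* TraceAlg Γ) (magnus Γ x) =
      magnus Γ (raagRetract Γ S x) := by
  have h : ((PowerSeries.map (algRetract Γ S : TraceAlg Γ →+* TraceAlg Γ) : (TraceAlg Γ)⟦X⟧ →+* _) :
      (TraceAlg Γ)⟦X⟧ →* (TraceAlg Γ)⟦X⟧).comp ((Units.coeHom _).comp (magnus Γ)) =
      (Units.coeHom _).comp ((magnus Γ).comp (raagRetract Γ S)) :=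
    raag_hom_ext fun v => by
      classical
      by_cases hv : v ∈ S <;>
        simp [magnus_gen, oneAddUnit_val, raagRetract_gen, hv, algRetract_var]
  exact DFunLike.congr_fun h x

theorem map_algRetract_star_of_eqMod {v : V} {F : (TraceAlg Γ)⟦X⟧} {N : ℕ}
    (h : EqMod (N + 1) ((magnus Γ (raagGen Γ v) : (TraceAlg Γ)⟦X⟧) * F)
      (F * (magnus Γ (raagGen Γ v) : (TraceAlg Γ)⟦X⟧))) :
    EqMod N (PowerSeries.map (algRetract Γ (star Γ v) : TraceAlg Γ →+* TraceAlg Γ) F) F := by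
  intro i hi
  rw [magnus_gen] at h
  rw [coeff_map]
  exact algRetract_star_of_commute Γ (coeff_commute_of_eqMod h (by omega))

end Magnus

end RaagOut

namespace RaagOut

open PowerSeries

section Cyclic

variable {V : Type*} (Γ : SimpleGraph V)

/-- Elementary moves on cyclic words: commutations of adjacent letters and rotations. -/
inductive CycStep : List V → List V → Prop
  | swap {l l' : List V} (h : Swap Γ l l') : CycStep l l'
  | rotate (p q : List V) : CycStep (p ++ q) (q ++ p)

/-- The product of powers of generators encoded by a list of syllables. -/
def syllProd (L : List (V × ℤ)) : RAAG Γ := (L.map fun s => raagGen Γ s.1 ^ s.2).prod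

theorem syllProd_append (L L' : List (V × ℤ)) :
    syllProd Γ (L ++ L') = syllProd Γ L * syllProd Γ L' := by
  simp [syllProd]

theorem syllProd_cons (s : V × ℤ) (L : List (V × ℤ)) :
    syllProd Γ (s :: L) = raagGen Γ s.1 ^ s.2 * syllProd Γ L := by
  simp [syllProd]

theorem exists_syllProd (x : RAAG Γ) : ∃ L, syllProd Γ L = x := by
  let H : Subgroup (RAAG Γ) :=
    { carrier := Set.range (syllProd Γ)
      mul_mem' := by
        rintro _ _ ⟨L, rfl⟩ ⟨L', rfl⟩
        exact ⟨L ++ L', syllProd_append Γ L L'⟩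
      one_mem' := ⟨[], rfl⟩
      inv_mem' := by
        rintro _ ⟨L, rfl⟩
        induction L with
        | nil => exact ⟨[], by simp [syllProd]⟩
        | cons s L ih =>
          obtain ⟨L', hL'⟩ := ih
          exact ⟨L' ++ [(s.1, -s.2)], by
            rw [syllProd_append, hL', syllProd_cons Γ s, mul_inv_rev]
            simp [syllProd]⟩ }
  exact raag_mem_of_gen (H := H) (fun v => ⟨[(v, 1)], by simp [syllProd]⟩) x

variable {Γ} in
theorem CycStep.symm {l l' : List V} (h : CycStep Γ l l') : CycStep Γ l' l := by
  obtain ⟨⟨p, q, hab⟩⟩ | ⟨p, q⟩ := h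
  · exact .swap (Swap.intro p q hab.symm)
  · exact .rotate q p

theorem isConj_mul_comm {G : Type*} [Group G] (a b : G) : IsConj (a * b) (b * a) :=
  isConj_iff.2 ⟨a⁻¹, by group⟩

variable {Γ} in
theorem CycStep.lift {l l' : List V} (h : CycStep Γ l l') {P : List (V × ℤ)}
    (hP : P.map Prod.fst = l) :
    ∃ P' : List (V × ℤ), P'.map Prod.fst = l' ∧ IsConj (syllProd Γ P) (syllProd Γ P') := by
  obtain ⟨⟨p, q, hab⟩⟩ | ⟨p, q⟩ := h
  · obtain ⟨P₁, R, rfl, rfl, hR⟩ := List.map_eq_append_iff.1 hP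
    obtain ⟨s, R, rfl, rfl, hR'⟩ := List.map_eq_cons_iff.1 hR
    obtain ⟨t, R, rfl, rfl, rfl⟩ := List.map_eq_cons_iff.1 hR'
    refine ⟨P₁ ++ t :: s :: R, by simp, ?_⟩
    have hc : Commute (raagGen Γ s.1 ^ s.2) (raagGen Γ t.1 ^ t.2) :=
      ((raagGen_commute Γ hab).zpow_left _).zpow_right _
    simp only [syllProd_append, syllProd_cons]
    rw [← mul_assoc (raagGen Γ s.1 ^ s.2), hc.eq, mul_assoc (raagGen Γ t.1 ^ t.2)]
  · obtain ⟨P₁, P₂, rfl, rfl, rfl⟩ := List.map_eq_append_iff.1 hP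
    refine ⟨P₂ ++ P₁, by simp, ?_⟩
    rw [syllProd_append, syllProd_append]
    exact isConj_mul_comm _ _

variable {Γ} in
theorem eqvGen_cycStep_lift {l l' : List V} (h : Relation.EqvGen (CycStep Γ) l l') :
    (∀ P : List (V × ℤ), P.map Prod.fst = l →
      ∃ P' : List (V × ℤ), P'.map Prod.fst = l' ∧ IsConj (syllProd Γ P) (syllProd Γ P')) ∧
    (∀ P : List (V × ℤ), P.map Prod.fst = l' →
      ∃ P' : List (V × ℤ), P'.map Prod.fst = l ∧ IsConj (syllProd Γ P) (syllProd Γ P')) := by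
  induction h with
  | rel _ _ h => exact ⟨fun _ hP => h.lift hP, fun _ hP => h.symm.lift hP⟩
  | refl _ => exact ⟨fun P hP => ⟨P, hP, IsConj.refl _⟩, fun P hP => ⟨P, hP, IsConj.refl _⟩⟩
  | symm _ _ _ ih => exact ih.symm
  | trans _ _ _ _ _ ih₁ ih₂ =>
    refine ⟨fun P hP => ?_, fun P hP => ?_⟩
    · obtain ⟨P₁, h₁, c₁⟩ := ih₁.1 P hP
      obtain ⟨P₂, h₂, c₂⟩ := ih₂.1 P₁ h₁
      exact ⟨P₂, h₂, c₁.trans c₂⟩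
    · obtain ⟨P₁, h₁, c₁⟩ := ih₂.2 P hP
      obtain ⟨P₂, h₂, c₂⟩ := ih₁.2 P₁ h₁
      exact ⟨P₂, h₂, c₁.trans c₂⟩

variable {Γ} in
theorem eqvGen_cycStep_length {l l' : List V} (h : Relation.EqvGen (CycStep Γ) l l') :
    l.length = l'.length := by
  induction h with
  | rel _ _ h =>
    obtain ⟨⟨p, q, -⟩⟩ | ⟨p, q⟩ := h
    · simp
    · simp [add_comm]
  | refl _ => rfl
  | symm _ _ _ ih => exact ih.symm
  | trans _ _ _ _ _ ih₁ ih₂ => exact ih₁.trans ih₂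

/-- `m` is represented by a word cyclically equivalent to `l`. -/
def CycEquiv (l : List V) (m : Trace Γ) : Prop :=
  ∃ l', Relation.EqvGen (CycStep Γ) l l' ∧ word Γ l' = m

theorem cycEquiv_word {l l' : List V} :
    CycEquiv Γ l (word Γ l') ↔ Relation.EqvGen (CycStep Γ) l l' := by
  refine ⟨?_, fun h => ⟨l', h, rfl⟩⟩
  rintro ⟨r, hr, e⟩
  exact hr.trans _ _ _ (((word_eq_iff Γ).1 e).mono fun _ _ h => .swap h)

theorem cycEquiv_mul_comm {l : List V} {m n : Trace Γ} (h : CycEquiv Γ l (m * n)) :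
    CycEquiv Γ l (n * m) := by
  obtain ⟨p, rfl⟩ := word_surjective Γ m
  obtain ⟨q, rfl⟩ := word_surjective Γ n
  rw [← word_append, cycEquiv_word] at h ⊢
  exact h.trans _ _ _ (.rel _ _ (.rotate p q))

open Classical in
/-- The linear functional counting traces cyclically equivalent to `l`. -/
noncomputable def cycTrace (l : List V) : TraceAlg Γ →ₗ[ℚ] ℚ :=
  (Finsupp.linearCombination ℚ fun m => if CycEquiv Γ l m then (1 : ℚ) else 0) ∘ₗ
    (MonoidAlgebra.coeffLinearEquiv ℚ).toLinearMap

open Classical in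
theorem cycTrace_single (l : List V) (m : Trace Γ) (r : ℚ) :
    cycTrace Γ l (MonoidAlgebra.single m r) = r * if CycEquiv Γ l m then (1 : ℚ) else 0 := by
  simp [cycTrace]

theorem cycTrace_mul_comm (l : List V) (a b : TraceAlg Γ) :
    cycTrace Γ l (a * b) = cycTrace Γ l (b * a) := by
  induction a using MonoidAlgebra.induction_on with
  | of m =>
    induction b using MonoidAlgebra.induction_on with
    | of n =>
      have : CycEquiv Γ l (m * n) ↔ CycEquiv Γ l (n * m) :=
        ⟨cycEquiv_mul_comm Γ, cycEquiv_mul_comm Γ⟩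
      simp [MonoidAlgebra.of_apply, MonoidAlgebra.single_mul_single, cycTrace_single]
      congr 1
      exact propext this
    | add a b ha hb => rw [mul_add, add_mul, map_add, map_add, ha, hb]
    | smul r a ha => rw [mul_smul_comm, smul_mul_assoc, map_smul, map_smul, ha]
  | add a b ha hb => rw [mul_add, add_mul, map_add, map_add, ha, hb]
  | smul r a ha => rw [mul_smul_comm, smul_mul_assoc, map_smul, map_smul, ha]

theorem cycTrace_mul_sq_mul {l : List V} {v : V}
    (h : ∀ p q, ¬ Relation.EqvGen (CycStep Γ) l (p ++ v :: v :: q)) (a b : TraceAlg Γ) :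
    cycTrace Γ l (a * (var Γ v * var Γ v) * b) = 0 := by
  induction a using MonoidAlgebra.induction_on with
  | of m =>
    induction b using MonoidAlgebra.induction_on with
    | of n =>
      obtain ⟨p, rfl⟩ := word_surjective Γ m
      obtain ⟨q, rfl⟩ := word_surjective Γ n
      have e : word Γ p * (letter Γ v * letter Γ v) * word Γ q = word Γ (p ++ v :: v :: q) := by
        rw [word_append, word_cons, word_cons Γ v q, mul_assoc, mul_assoc]
      simp only [var, MonoidAlgebra.of_apply, MonoidAlgebra.single_mul_single, cycTrace_single, e]
      rw [if_neg fun hc => h p q ((cycEquiv_word Γ).1 hc), mul_zero]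
    | add a b ha hb => rw [mul_add, map_add, ha, hb, add_zero]
    | smul r a ha => rw [mul_smul_comm, map_smul, ha, smul_zero]
  | add a b ha hb => rw [add_mul, add_mul, map_add, ha, hb, add_zero]
  | smul r a ha => rw [smul_mul_assoc, smul_mul_assoc, map_smul, ha, smul_zero]

end Cyclic

section Expansion

theorem exists_zpow_eq_of_eq_one_add {R : Type*} [Ring R] {U : Rˣ} {y : R} (hU : (U : R) = 1 + y)
    (e : ℤ) : ∃ u : R, ((U ^ e : Rˣ) : R) = 1 + e * y + y * y * u := by
  have hc : ∀ (e : ℤ) (z : R), y * (e * z) = e * (y * z) := fun e z => by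
    rw [← mul_assoc, ← mul_assoc, Int.cast_commute e y]
  have hc' : ∀ (e : ℤ), y * e = e * y := fun e => (Int.cast_commute e y).eq.symm
  induction e with
  | zero => exact ⟨0, by simp⟩
  | succ n ih =>
    obtain ⟨u, hu⟩ := ih
    refine ⟨(n : ℤ) + u + y * u, ?_⟩
    rw [add_comm, zpow_add, zpow_one, Units.val_mul, hu, hU, Int.cast_add, Int.cast_one]
    simp only [mul_add, add_mul, mul_assoc, hc, hc', one_mul, mul_one]
    abel
  | pred n ih =>
    obtain ⟨u, hu⟩ := ih
    have h₁ : ((U⁻¹ : Rˣ) : R) = 1 - y * ((U⁻¹ : Rˣ) : R) := by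
      rw [eq_sub_iff_add_eq]
      simpa [hU, add_mul] using U.mul_inv
    have h₂ : ((U⁻¹ : Rˣ) : R) = 1 - y + y * y * ((U⁻¹ : Rˣ) : R) := by
      conv_lhs => rw [h₁, h₁]
      simp only [mul_sub, mul_one, mul_assoc]
      abel
    set W : R := ((U⁻¹ : Rˣ) : R)
    set e : ℤ := -n
    refine ⟨u - e - y * u + W * (1 + e * y + y * y * u), ?_⟩
    rw [sub_eq_add_neg, add_comm, zpow_add, zpow_neg_one, Units.val_mul, hu, add_comm (-1 : ℤ),
      ← sub_eq_add_neg, Int.cast_sub, Int.cast_one]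
    change W * _ = _
    clear_value W e
    conv_lhs => rw [h₂]
    simp only [mul_add, add_mul, mul_sub, sub_mul, mul_assoc, hc, hc', one_mul, mul_one]
    abel

variable {A : Type*} [Ring A]

theorem coeff_prod_oneAdd (l : List A) :
    coeff l.length (l.map fun a => (1 + C a * X : A⟦X⟧)).prod = l.prod ∧
      ∀ j, l.length < j → coeff j (l.map fun a => (1 + C a * X : A⟦X⟧)).prod = 0 := by
  induction l with
  | nil => exact ⟨by simp, fun j hj => by
      have := Nat.ne_zero_of_lt hj
      simp [coeff_one, this]⟩
  | cons a l ih =>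
    have h : ∀ j, coeff (j + 1) ((a :: l).map fun a => (1 + C a * X : A⟦X⟧)).prod =
        coeff (j + 1) (l.map fun a => (1 + C a * X : A⟦X⟧)).prod +
          a * coeff j (l.map fun a => (1 + C a * X : A⟦X⟧)).prod := by
      intro j
      rw [List.map_cons, List.prod_cons, add_mul, one_mul, map_add, mul_assoc, coeff_C_mul, X_mul,
        coeff_succ_mul_X]
    refine ⟨?_, fun j hj => ?_⟩
    · rw [List.length_cons, h, ih.2 _ (Nat.lt_succ_self _), ih.1, zero_add, List.prod_cons]
    · obtain ⟨j, rfl⟩ := Nat.exists_eq_succ_of_ne_zero (Nat.ne_zero_of_lt hj)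
      rw [List.length_cons, Nat.succ_lt_succ_iff] at hj
      rw [Nat.succ_eq_add_one, h, ih.2 _ (by omega), ih.2 _ hj, mul_zero, add_zero]

variable [Algebra ℚ A] (lam : A →ₗ[ℚ] ℚ)

theorem apply_coeff_mul_comm (h : ∀ a b, lam (a * b) = lam (b * a)) (n : ℕ) (F G : A⟦X⟧) :
    lam (coeff n (F * G)) = lam (coeff n (G * F)) := by
  rw [coeff_mul, coeff_mul, ← Finset.Nat.sum_antidiagonal_swap, map_sum, map_sum]
  exact Finset.sum_congr rfl fun p _ => h _ _

/-- Power series contributing nothing to a linear functional on coefficients, in any product. -/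
def Negligible (F : A⟦X⟧) : Prop := ∀ (P Q : A⟦X⟧) (n : ℕ), lam (coeff n (P * F * Q)) = 0

variable {lam}

theorem Negligible.add {F G : A⟦X⟧} (hF : Negligible lam F) (hG : Negligible lam G) :
    Negligible lam (F + G) := fun P Q n => by
  rw [mul_add, add_mul, map_add, map_add, hF, hG, add_zero]

theorem Negligible.mul_left {F : A⟦X⟧} (hF : Negligible lam F) (G : A⟦X⟧) :
    Negligible lam (G * F) := fun P Q n => by rw [← mul_assoc P]; exact hF _ _ _

theorem Negligible.mul_right {F : A⟦X⟧} (hF : Negligible lam F) (G : A⟦X⟧) :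
    Negligible lam (F * G) := fun P Q n => by
  rw [← mul_assoc P, mul_assoc (P * F)]; exact hF _ _ _

theorem negligible_C {c : A} (hc : ∀ a b, lam (a * c * b) = 0) :
    Negligible lam (C c : A⟦X⟧) := fun P Q n => by
  rw [coeff_mul, map_sum]
  refine Finset.sum_eq_zero fun p _ => ?_
  rw [coeff_mul_C]
  exact hc _ _

theorem negligible_prod {ι : Type*} (L : List ι) {F G : ι → A⟦X⟧}
    (h : ∀ i ∈ L, Negligible lam (F i - G i)) :
    Negligible lam ((L.map F).prod - (L.map G).prod) := by
  induction L with
  | nil => intro P Q n; simp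
  | cons i L ih =>
    have e : ((i :: L).map F).prod - ((i :: L).map G).prod =
        (F i - G i) * (L.map F).prod + G i * ((L.map F).prod - (L.map G).prod) := by
      simp only [List.map_cons, List.prod_cons]
      noncomm_ring
    rw [e]
    exact ((h i List.mem_cons_self).mul_right _).add
      ((ih fun j hj => h j (List.mem_cons_of_mem _ hj)).mul_left _)

end Expansion

section Detection

variable {V : Type*} (Γ : SimpleGraph V)

theorem magnus_syllProd (L : List (V × ℤ)) : (magnus Γ (syllProd Γ L) : (TraceAlg Γ)⟦X⟧) =
    (L.map fun s =>
      ((oneAddUnit (var Γ s.1) ^ s.2 : ((TraceAlg Γ)⟦X⟧)ˣ) : (TraceAlg Γ)⟦X⟧)).prod := by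
  induction L with
  | nil => simp [syllProd]
  | cons s L ih =>
    rw [syllProd_cons, map_mul, Units.val_mul, ih, map_zpow, magnus_gen, List.map_cons,
      List.prod_cons]

theorem prod_map_smul_var (L : List (V × ℤ)) :
    (L.map fun s => (s.2 : TraceAlg Γ) * var Γ s.1).prod =
      MonoidAlgebra.single (word Γ (L.map Prod.fst)) ((L.map fun s => (s.2 : ℚ)).prod) := by
  induction L with
  | nil => rfl
  | cons s L ih =>
    have e : (s.2 : TraceAlg Γ) * var Γ s.1 = MonoidAlgebra.single (letter Γ s.1) (s.2 : ℚ) := by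
      rw [← zsmul_eq_mul, var, MonoidAlgebra.smul_single]
      simp
    rw [List.map_cons, List.prod_cons, ih, e, MonoidAlgebra.single_mul_single, List.map_cons,
      List.map_cons, List.prod_cons, word_cons]

/-- A list of syllables of minimal length among those representing a given conjugacy class. -/
theorem exists_minimal_syllProd (x : RAAG Γ) : ∃ L, IsConj x (syllProd Γ L) ∧
    ∀ L', IsConj x (syllProd Γ L') → L.length ≤ L'.length := by
  obtain ⟨L₀, hL₀⟩ := exists_syllProd Γ x
  obtain ⟨L, hL, hmin⟩ := (measure List.length).wf.has_min
    {L : List (V × ℤ) | IsConj x (syllProd Γ L)} ⟨L₀, by rw [Set.mem_ofPred_eq, hL₀]⟩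
  exact ⟨L, hL, fun L' hL' => not_lt.1 (hmin L' hL')⟩

/-- Every conjugacy class is detected by a trace functional on a coefficient of its image under the
Magnus representation, in degree equal to its syllable length. -/
theorem exists_trace_detecting (x : RAAG Γ) : ∃ L, IsConj x (syllProd Γ L) ∧
    ∃ lam : TraceAlg Γ →ₗ[ℚ] ℚ, (∀ a b, lam (a * b) = lam (b * a)) ∧
      lam (coeff L.length (magnus Γ x : (TraceAlg Γ)⟦X⟧)) ≠ 0 := by
  obtain ⟨L, hL, hmin⟩ := exists_minimal_syllProd Γ x
  refine ⟨L, hL, cycTrace Γ (L.map Prod.fst), cycTrace_mul_comm Γ _, ?_⟩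
  have hne : ∀ s ∈ L, s.2 ≠ 0 := by
    intro s hs h0
    obtain ⟨P, Q, rfl⟩ := List.append_of_mem hs
    have := hmin (P ++ Q) (by simpa [syllProd_append, syllProd_cons, h0] using hL)
    simp at this
  have hsq : ∀ v p q, ¬ Relation.EqvGen (CycStep Γ) (L.map Prod.fst) (p ++ v :: v :: q) := by
    intro v p q h
    obtain ⟨P', hP', hc⟩ := (eqvGen_cycStep_lift h).1 L rfl
    have hlen : P'.length = L.length := by
      simpa [← hP'] using (eqvGen_cycStep_length h).symm
    obtain ⟨P, R, rfl, rfl, hR⟩ := List.map_eq_append_iff.1 hP'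
    obtain ⟨s, R, rfl, rfl, hR'⟩ := List.map_eq_cons_iff.1 hR
    obtain ⟨t, R, rfl, hts, rfl⟩ := List.map_eq_cons_iff.1 hR'
    have := hmin (P ++ (s.1, s.2 + t.2) :: R) (by
      refine (hL.trans hc).trans (Eq.subst ?_ (IsConj.refl _))
      simp only [syllProd_append, syllProd_cons, hts, zpow_add, mul_assoc])
    simp at this hlen
    omega
  obtain ⟨c, hc⟩ := isConj_iff.1 hL
  have hx : cycTrace Γ (L.map Prod.fst) (coeff L.length (magnus Γ x : (TraceAlg Γ)⟦X⟧)) =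
      cycTrace Γ (L.map Prod.fst) (coeff L.length (magnus Γ (syllProd Γ L) : (TraceAlg Γ)⟦X⟧)) := by
    rw [← hc, map_mul, map_mul, map_inv, Units.val_mul, Units.val_mul,
      apply_coeff_mul_comm _ (cycTrace_mul_comm Γ _), ← mul_assoc, Units.inv_mul, one_mul]
  have hn : Negligible (cycTrace Γ (L.map Prod.fst))
      ((magnus Γ (syllProd Γ L) : (TraceAlg Γ)⟦X⟧) -
        (L.map fun s => (1 + C ((s.2 : TraceAlg Γ) * var Γ s.1) * X : (TraceAlg Γ)⟦X⟧)).prod) := by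
    rw [magnus_syllProd]
    refine negligible_prod L fun s _ => ?_
    obtain ⟨u, hu⟩ := exists_zpow_eq_of_eq_one_add (oneAddUnit_val (var Γ s.1)) s.2
    have e : ((oneAddUnit (var Γ s.1) ^ s.2 : ((TraceAlg Γ)⟦X⟧)ˣ) : (TraceAlg Γ)⟦X⟧) -
        (1 + C ((s.2 : TraceAlg Γ) * var Γ s.1) * X) =
        C (var Γ s.1 * var Γ s.1) * (X * X * u) := by
      rw [hu, map_mul, map_intCast, map_mul, mul_assoc (C (var Γ s.1)) X, ← mul_assoc X,
        X_mul]
      noncomm_ring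
    rw [e]
    exact (negligible_C (cycTrace_mul_sq_mul Γ (hsq s.1))).mul_right _
  have h0 := hn 1 1 L.length
  rw [one_mul, mul_one, map_sub, map_sub, sub_eq_zero] at h0
  have h1 := (coeff_prod_oneAdd (L.map fun s => (s.2 : TraceAlg Γ) * var Γ s.1)).1
  rw [List.length_map, List.map_map, prod_map_smul_var] at h1
  rw [hx, h0]
  refine ne_of_eq_of_ne (congrArg _ h1) ?_
  rw [cycTrace_single, if_pos ((cycEquiv_word Γ).2 (.refl _)), mul_one]
  refine List.prod_ne_zero fun h => ?_
  obtain ⟨s, hs, h⟩ := List.mem_map.1 h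
  exact hne s hs (by exact_mod_cast h)

theorem magnus_injective : Function.Injective (magnus Γ) := by
  refine (injective_iff_map_eq_one _).2 fun x hx => ?_
  obtain ⟨L, hL, lam, -, h⟩ := exists_trace_detecting Γ x
  cases L with
  | nil => exact isConj_one_left.1 hL
  | cons s L => simp [hx, coeff_one] at h

theorem isConj_gen_of_eqMod {x : RAAG Γ} {v : V}
    (hab : ∀ f : RAAG Γ →* Multiplicative ℤ, f x = f (raagGen Γ v))
    (h : ∀ N, ∃ U : ((TraceAlg Γ)⟦X⟧)ˣ, EqMod N
      ((U : (TraceAlg Γ)⟦X⟧) * (magnus Γ (raagGen Γ v) : (TraceAlg Γ)⟦X⟧))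
      ((magnus Γ x : (TraceAlg Γ)⟦X⟧) * (U : (TraceAlg Γ)⟦X⟧))) :
    IsConj (raagGen Γ v) x := by
  classical
  obtain ⟨L, hL, lam, hlam, hne⟩ := exists_trace_detecting Γ x
  have hf : ∀ f : RAAG Γ →* Multiplicative ℤ, f (syllProd Γ L) = f (raagGen Γ v) := by
    intro f
    rw [← hab f, isConj_iff_eq.1 (MonoidHom.map_isConj f hL)]
  let f : RAAG Γ →* Multiplicative ℤ :=
    raagLift Γ (fun w => Multiplicative.ofAdd (if w = v then 1 else 0)) fun _ _ _ => Commute.all _ _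
  have hfv : f (raagGen Γ v) = Multiplicative.ofAdd 1 := by simp [f, raagLift_gen]
  match L with
  | [] =>
    have := (hf f).symm
    rw [hfv] at this
    simp [syllProd] at this
  | [s] =>
    have e : syllProd Γ [s] = raagGen Γ s.1 ^ s.2 := by simp [syllProd]
    have := hf f
    rw [hfv, e, map_zpow, raagLift_gen, ← ofAdd_zsmul] at this
    have := Multiplicative.ofAdd.injective this
    by_cases hs : s.1 = v
    · simp [hs] at this
      rw [e, hs, this, zpow_one] at hL
      exact hL.symm
    · simp [hs] at this
  | s :: t :: L =>
    exfalso
    apply hne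
    obtain ⟨U, hU⟩ := h ((s :: t :: L).length + 1)
    have h' := (hU.mul (EqMod.refl _ (↑U⁻¹ : (TraceAlg Γ)⟦X⟧))) _ (Nat.lt_succ_self _)
    rw [mul_assoc _ (U : (TraceAlg Γ)⟦X⟧), Units.mul_inv, mul_one] at h'
    rw [← h', apply_coeff_mul_comm _ hlam, ← mul_assoc, Units.inv_mul, one_mul, magnus_gen,
      oneAddUnit_val]
    simp [coeff_one, coeff_succ_mul_X]

end Detection

end RaagOut

namespace RaagOut

section Root

open Polynomial in
theorem exists_poly_root {n : ℕ} (hn : n ≠ 0) (N : ℕ) : ∃ q r : ℚ[X],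
    X ^ N ∣ q ^ n - (1 + X) ∧ X ^ N ∣ q * r - 1 ∧ X ∣ q - 1 ∧ X ∣ r - 1 := by
  let B : ℚ → PowerSeries ℚ := PowerSeries.binomialSeries ℚ
  let T : ℚ → ℚ[X] := fun e => PowerSeries.trunc (N + 1) (B e)
  have hB : ∀ (e : ℚ) (k : ℕ), B e ^ k = B (k * e) := by
    intro e k
    induction k with
    | zero => simp [B, PowerSeries.binomialSeries_zero]
    | succ k ih =>
      rw [pow_succ, ih, ← PowerSeries.binomialSeries_add]
      congr 1
      push_cast
      ring
  have hdvd : ∀ {M : ℕ} {p : ℚ[X]}, (PowerSeries.X ^ M : PowerSeries ℚ) ∣ p → X ^ M ∣ p := by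
    intro M p h
    rw [PowerSeries.X_pow_dvd_iff] at h
    refine Polynomial.X_pow_dvd_iff.2 fun d hd => ?_
    simpa using h d hd
  have hT : ∀ e, (PowerSeries.X ^ (N + 1) : PowerSeries ℚ) ∣ (T e : PowerSeries ℚ) - B e := by
    intro e
    refine PowerSeries.X_pow_dvd_iff.2 fun d hd => ?_
    rw [map_sub, PowerSeries.coeff_coe_trunc_of_lt hd, sub_self]
  have h1 : ∀ e, X ∣ T e - 1 := by
    intro e
    have : (T e).coeff 0 = 1 := by simp [T, B, PowerSeries.coeff_trunc]
    simp [Polynomial.X_dvd_iff, this]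
  have hn' : (n : ℚ) ≠ 0 := by exact_mod_cast hn
  refine ⟨T (1 / n), T (-(1 / n)), hdvd ?_, hdvd ?_, h1 _, h1 _⟩
  · have e : B (1 / n) ^ n = 1 + PowerSeries.X := by
      rw [hB, mul_one_div_cancel hn']
      simpa using PowerSeries.binomialSeries_nat (R := ℚ) (A := ℚ) 1
    have := ((pow_dvd_pow _ (Nat.le_succ N)).trans (hT (1 / n))).trans
      (sub_dvd_pow_sub_pow _ _ n)
    rw [e] at this
    simpa using this
  · have e : B (1 / n) * B (-(1 / n)) = 1 := by
      rw [← PowerSeries.binomialSeries_add, add_neg_cancel, PowerSeries.binomialSeries_zero]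
    have h₁ := (pow_dvd_pow _ (Nat.le_succ N)).trans (hT (1 / n))
    have h₂ := (pow_dvd_pow _ (Nat.le_succ N)).trans (hT (-(1 / n)))
    have := dvd_add (h₁.mul_right (T (-(1 / n)))) (h₂.mul_left (B (1 / n)))
    convert this using 1
    simp only [coe_sub, coe_mul, coe_one, mul_sub, sub_mul, e]
    ring

open Polynomial in
theorem aeval_mem_of_dvd {R : Type*} [Ring R] [Algebra ℚ R] {J : ℕ → Submodule ℚ R}
    (hmul : ∀ k l a b, a ∈ J k → b ∈ J l → a * b ∈ J (k + l)) (h0 : J 0 = ⊤) {t : R}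
    (ht : t ∈ J 1) {N : ℕ} {p : ℚ[X]} (hp : X ^ N ∣ p) : aeval t p ∈ J N := by
  have hpow : ∀ k, t ^ k ∈ J k := by
    intro k
    induction k with
    | zero => simp [h0]
    | succ k ih => rw [pow_succ]; exact hmul _ _ _ _ ih ht
  obtain ⟨s, rfl⟩ := hp
  rw [map_mul, map_pow, aeval_X]
  exact hmul _ 0 _ _ (hpow N) (by simp [h0])

/-- A unipotent automorphism of a filtered algebra, some positive power of which is conjugation by
a unipotent fixed element, is itself conjugation by a unipotent element up to any given order. -/
theorem exists_approx_conj {R : Type*} [Ring R] [Algebra ℚ R] {J : ℕ → Submodule ℚ R}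
    (hmul : ∀ k l a b, a ∈ J k → b ∈ J l → a * b ∈ J (k + l)) (h0 : J 0 = ⊤) (hJ : Antitone J)
    (Φ : R →ₐ[ℚ] R) (hΦ : ∀ k, ∀ a ∈ J k, Φ a - a ∈ J (k + 1)) {n : ℕ}
    (hn : n ≠ 0) {u v : R} (hvu : v * u = 1) (hu1 : u - 1 ∈ J 1) (hu : Φ u = u)
    (hpow : ∀ a, (Φ^[n]) a = u * a * v) (N : ℕ) :
    ∃ h : R, h - 1 ∈ J 1 ∧ ∀ a, Φ a * h - h * a ∈ J N := by
  obtain ⟨q, r, hq, hr, hq1, hr1⟩ := exists_poly_root hn N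
  set t := u - 1 with ht
  set h := Polynomial.aeval t q with hh
  set h' := Polynomial.aeval t r with hh'
  have mulL : ∀ k a b, b ∈ J k → a * b ∈ J k := fun k a b hb => by
    simpa using hmul 0 k a b (by simp [h0]) hb
  have mulR : ∀ k a b, a ∈ J k → a * b ∈ J k := fun k a b ha => by
    simpa using hmul k 0 a b ha (by simp [h0])
  have aev : ∀ {k p}, (Polynomial.X ^ k ∣ p) → Polynomial.aeval t p ∈ J k :=
    aeval_mem_of_dvd hmul h0 hu1
  have hfix : ∀ p : Polynomial ℚ, Φ (Polynomial.aeval t p) = Polynomial.aeval t p := fun p => by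
    rw [← Polynomial.aeval_algHom_apply, ht, map_sub, hu, map_one]
  have hh1 : h - 1 ∈ J 1 := by
    rw [hh, ← map_one (Polynomial.aeval (R := ℚ) t), ← map_sub]
    exact aev (by simpa using hq1)
  have hh1' : h' - 1 ∈ J 1 := by
    rw [hh', ← map_one (Polynomial.aeval (R := ℚ) t), ← map_sub]
    exact aev (by simpa using hr1)
  have hcomm : Commute h h' := by
    rw [commute_iff_eq, hh, hh', ← map_mul, mul_comm, map_mul]
  have hinv : h * h' - 1 ∈ J N := by simpa using aev hr
  have hroot : h ^ n - u ∈ J N := by simpa [ht] using aev hq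
  let E : R → R := fun a => h' * Φ a * h - a
  have hEsub : ∀ a b, E (a - b) = E a - E b := fun a b => by
    simp only [E, map_sub]; noncomm_ring
  have hE : ∀ k, ∀ a ∈ J k, E a ∈ J (k + 1) := by
    intro k a ha
    have e : E a = h' * (Φ a - a) * h + ((h' - 1) * a * h + a * (h - 1)) := by
      simp only [E]; noncomm_ring
    rw [e]
    refine add_mem (mulR _ _ _ (mulL _ _ _ (hΦ k a ha))) (add_mem (mulR _ _ _ ?_) ?_)
    · rw [add_comm]; exact hmul _ _ _ _ hh1' ha
    · exact hmul _ _ _ _ ha hh1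
  let Ψ : R → R := fun a => h' * Φ a * h
  have hΨ : ∀ m a, (Ψ^[m]) a = h' ^ m * (Φ^[m]) a * h ^ m := by
    intro m
    induction m with
    | zero => intro a; simp
    | succ m ih =>
      intro a
      rw [Function.iterate_succ_apply', Function.iterate_succ_apply', ih, pow_succ' h', pow_succ h]
      simp only [Ψ, map_mul, map_pow, hh, hh', hfix, mul_assoc]
  have hinv' : h' ^ n * h ^ n - 1 ∈ J N := by
    have hd := hr.trans (sub_one_dvd_pow_sub_one (q * r) n)
    rw [mul_pow, mul_comm] at hd
    simpa [map_sub] using aev hd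
  have hΨn : ∀ a, (Ψ^[n]) a - a ∈ J N := by
    intro a
    have e : (Ψ^[n]) a - a = ((h' ^ n * h ^ n - 1) - h' ^ n * (h ^ n - u)) * (a * v * h ^ n) +
        a * (v * (h ^ n - u)) + a * (v * u - 1) := by
      rw [hΨ, hpow]; noncomm_ring
    rw [e, hvu, sub_self, mul_zero, add_zero]
    exact add_mem (mulR _ _ _ (sub_mem hinv' (mulL _ _ _ hroot)))
      (mulL _ _ _ (mulL _ _ _ hroot))
  have hEN : ∀ k ≤ N, ∀ a, E a ∈ J k := by
    intro k
    induction k with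
    | zero => simp [h0]
    | succ k ih =>
      intro hk a
      have ih := ih (by omega)
      have key : ∀ m, (Ψ^[m]) a - a - (m : ℚ) • E a ∈ J (k + 1) ∧ (Ψ^[m]) a - a ∈ J k := by
        intro m
        induction m with
        | zero => simp
        | succ m ihm =>
          have e : (Ψ^[m + 1]) a = (Ψ^[m]) a + E ((Ψ^[m]) a) := by
            rw [Function.iterate_succ_apply']; simp [E, Ψ]
          constructor
          · have e' : (Ψ^[m + 1]) a - a - ((m + 1 : ℕ) : ℚ) • E a =
                ((Ψ^[m]) a - a - (m : ℚ) • E a) + E ((Ψ^[m]) a - a) := by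
              rw [e, hEsub]; push_cast; module
            rw [e']
            exact add_mem ihm.1 (hE k _ ihm.2)
          · rw [e, add_sub_right_comm]
            exact add_mem ihm.2 (ih _)
      have h1 := (Submodule.sub_mem_iff_right _ (hJ hk (hΨn a))).1 (key n).1
      exact ((J (k + 1)).smul_mem_iff (by exact_mod_cast hn)).1 h1
  refine ⟨h, hh1, fun a => ?_⟩
  have e : Φ a * h - h * a = h * E a - (h * h' - 1) * (Φ a * h) := by
    simp only [E]; noncomm_ring
  rw [e]
  exact sub_mem (mulL _ _ _ (hEN N le_rfl a)) (mulR _ _ _ hinv)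

end Root

section GroupRing

variable {G : Type*} [Group G]

variable (G) in
/-- The augmentation ideal of the rational group ring. -/
noncomputable def augIdeal : Submodule ℚ (MonoidAlgebra ℚ G) :=
  Submodule.span ℚ (Set.range fun g : G => MonoidAlgebra.single g 1 - 1)

variable (G) in
/-- The filtration of the rational group ring by powers of the augmentation ideal. -/
noncomputable def augFilt : ℕ → Submodule ℚ (MonoidAlgebra ℚ G)
  | 0 => ⊤
  | k + 1 => augIdeal G * augFilt k

theorem top_mul_augIdeal_le :
    (⊤ : Submodule ℚ (MonoidAlgebra ℚ G)) * augIdeal G ≤ augIdeal G * ⊤ := by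
  rw [Submodule.mul_le]
  intro x hx m hm
  clear hx
  induction x using MonoidAlgebra.induction_on with
  | of z =>
    induction hm using Submodule.span_induction with
    | mem m hm =>
      obtain ⟨y, rfl⟩ := hm
      have e : MonoidAlgebra.of ℚ G z * (MonoidAlgebra.single y 1 - 1) =
          (MonoidAlgebra.single (z * y * z⁻¹) 1 - 1) * MonoidAlgebra.single z 1 := by
        rw [MonoidAlgebra.of_apply, mul_sub, sub_mul, MonoidAlgebra.single_mul_single,
          MonoidAlgebra.single_mul_single, inv_mul_cancel_right, one_mul, one_mul, mul_one]
      rw [e]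
      exact Submodule.mul_mem_mul (Submodule.subset_span ⟨_, rfl⟩) trivial
    | zero => simp
    | add a b _ _ ha hb => rw [mul_add]; exact add_mem ha hb
    | smul r a _ ha => rw [mul_smul_comm]; exact Submodule.smul_mem _ _ ha
  | add a b ha hb => rw [add_mul]; exact add_mem ha hb
  | smul r a ha => rw [smul_mul_assoc]; exact Submodule.smul_mem _ _ ha

theorem augFilt_mul_le (k l : ℕ) : augFilt G k * augFilt G l ≤ augFilt G (k + l) := by
  induction k with
  | zero =>
    rw [zero_add]
    change ⊤ * _ ≤ _
    induction l with
    | zero => exact le_top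
    | succ l ih =>
      change ⊤ * (augIdeal G * augFilt G l) ≤ augIdeal G * augFilt G l
      rw [← mul_assoc]
      refine (mul_le_mul_left (top_mul_augIdeal_le (G := G)) (augFilt G l)).trans ?_
      rw [mul_assoc]
      exact mul_le_mul_right ih _
  | succ k ih =>
    rw [add_right_comm]
    change augIdeal G * augFilt G k * _ ≤ augIdeal G * _
    rw [mul_assoc]
    exact mul_le_mul_right ih _

theorem mul_mem_augFilt (k l : ℕ) (a b : MonoidAlgebra ℚ G) (ha : a ∈ augFilt G k)
    (hb : b ∈ augFilt G l) : a * b ∈ augFilt G (k + l) :=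
  augFilt_mul_le k l (Submodule.mul_mem_mul ha hb)

theorem augFilt_antitone : Antitone (augFilt G) := by
  refine antitone_nat_of_succ_le fun k => ?_
  induction k with
  | zero => exact le_top
  | succ k ih => exact mul_le_mul_right ih _

theorem single_sub_one_mem_augFilt_one (g : G) :
    MonoidAlgebra.single g (1 : ℚ) - 1 ∈ augFilt G 1 := by
  rw [← mul_one (MonoidAlgebra.single g (1 : ℚ) - 1)]
  exact Submodule.mul_mem_mul (Submodule.subset_span ⟨g, rfl⟩) trivial

theorem single_sub_one_mem_augFilt_two {c : G} (hc : c ∈ commutator G) :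
    MonoidAlgebra.single c (1 : ℚ) - 1 ∈ augFilt G 2 := by
  have hR : ∀ a b, a ∈ augFilt G 2 → a * b ∈ augFilt G 2 := fun a b ha =>
    mul_mem_augFilt 2 0 a b ha trivial
  let H : Subgroup G :=
    { carrier := {c | MonoidAlgebra.single c (1 : ℚ) - 1 ∈ augFilt G 2}
      mul_mem' := by
        intro a b ha hb
        have e : MonoidAlgebra.single (a * b) (1 : ℚ) - 1 =
            (MonoidAlgebra.single a 1 - 1) * MonoidAlgebra.single b 1 +
              (MonoidAlgebra.single b 1 - 1) := by
          rw [sub_mul, MonoidAlgebra.single_mul_single, mul_one, one_mul]; abel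
        change _ ∈ augFilt G 2
        rw [e]
        exact add_mem (hR _ _ ha) hb
      one_mem' := by
        change _ ∈ augFilt G 2
        rw [← MonoidAlgebra.one_def, sub_self]
        exact zero_mem _
      inv_mem' := by
        intro a ha
        have e : MonoidAlgebra.single a⁻¹ (1 : ℚ) - 1 =
            -((MonoidAlgebra.single a 1 - 1) * MonoidAlgebra.single a⁻¹ 1) := by
          rw [sub_mul, MonoidAlgebra.single_mul_single, mul_inv_cancel, mul_one, one_mul,
            ← MonoidAlgebra.one_def]; abel
        change _ ∈ augFilt G 2
        rw [e]
        exact neg_mem (hR _ _ ha) }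
  have hle : commutator G ≤ H := by
    rw [commutator_def, Subgroup.commutator_le]
    intro a _ b _
    have e : MonoidAlgebra.single (a * b * a⁻¹ * b⁻¹) (1 : ℚ) - 1 =
        ((MonoidAlgebra.single a 1 - 1) * (MonoidAlgebra.single b 1 - 1) -
          (MonoidAlgebra.single b 1 - 1) * (MonoidAlgebra.single a 1 - 1)) *
            MonoidAlgebra.single (a⁻¹ * b⁻¹) 1 := by
      have e₁ : (MonoidAlgebra.single a (1 : ℚ) - 1) * (MonoidAlgebra.single b 1 - 1) -
          (MonoidAlgebra.single b 1 - 1) * (MonoidAlgebra.single a 1 - 1) =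
          MonoidAlgebra.single a 1 * MonoidAlgebra.single b 1 -
            MonoidAlgebra.single b 1 * MonoidAlgebra.single a 1 := by noncomm_ring
      rw [e₁, sub_mul]
      simp only [MonoidAlgebra.single_mul_single, mul_one, MonoidAlgebra.one_def]
      congr 2
      all_goals group
    change MonoidAlgebra.single (a * b * a⁻¹ * b⁻¹) (1 : ℚ) - 1 ∈ augFilt G 2
    rw [e]
    have h₁ := single_sub_one_mem_augFilt_one a
    have h₂ := single_sub_one_mem_augFilt_one b
    exact hR _ _ (sub_mem (mul_mem_augFilt 1 1 _ _ h₁ h₂) (mul_mem_augFilt 1 1 _ _ h₂ h₁))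
  exact hle hc

/-- The endomorphism of the rational group ring induced by an automorphism of the group. -/
noncomputable def ringAut (φ : MulAut G) : MonoidAlgebra ℚ G →ₐ[ℚ] MonoidAlgebra ℚ G :=
  MonoidAlgebra.mapDomainAlgHom ℚ ℚ (φ : G →* G)

theorem ringAut_single (φ : MulAut G) (g : G) (r : ℚ) :
    ringAut φ (MonoidAlgebra.single g r) = MonoidAlgebra.single (φ g) r := by
  simp [ringAut]

theorem ringAut_sub_mem_augFilt {φ : MulAut G} (hφ : ∀ y, φ y * y⁻¹ ∈ commutator G) (k : ℕ)
    (a : MonoidAlgebra ℚ G) (ha : a ∈ augFilt G k) : ringAut φ a - a ∈ augFilt G (k + 1) := by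
  have h2 : ∀ a, ringAut φ a - a ∈ augFilt G 2 := by
    intro a
    induction a using MonoidAlgebra.induction_on with
    | of y =>
      have e : ringAut φ (MonoidAlgebra.of ℚ G y) - MonoidAlgebra.of ℚ G y =
          (MonoidAlgebra.single (φ y * y⁻¹) 1 - 1) * MonoidAlgebra.single y 1 := by
        rw [MonoidAlgebra.of_apply, ringAut_single, sub_mul, MonoidAlgebra.single_mul_single,
          inv_mul_cancel_right, one_mul, one_mul]
      rw [e]
      exact mul_mem_augFilt 2 0 _ _ (single_sub_one_mem_augFilt_two (hφ y)) trivial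
    | add a b ha hb => rw [map_add, add_sub_add_comm]; exact add_mem ha hb
    | smul r a ha => rw [map_smul, ← smul_sub]; exact Submodule.smul_mem _ _ ha
  induction k generalizing a with
  | zero => exact augFilt_antitone (by omega) (h2 a)
  | succ k ih =>
    refine Submodule.mul_induction_on ha (fun x hx b hb => ?_) fun x y hx hy => ?_
    · have e : ringAut φ (x * b) - x * b =
          (ringAut φ x - x) * (b + (ringAut φ b - b)) + x * (ringAut φ b - b) := by
        rw [map_mul]; noncomm_ring
      have hb' := ih b hb
      have hx1 : x ∈ augFilt G 1 := mul_one x ▸ Submodule.mul_mem_mul hx trivial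
      rw [e]
      refine add_mem ?_ ?_
      · have := mul_mem_augFilt 2 k _ _ (h2 x) (add_mem hb (augFilt_antitone (Nat.le_succ k) hb'))
        rwa [add_comm 2 k] at this
      · have := mul_mem_augFilt 1 (k + 1) _ _ hx1 hb'
        rwa [add_comm 1 (k + 1)] at this
    · rw [map_add, add_sub_add_comm]; exact add_mem hx hy

theorem exists_approx_conj_groupRing {φ : MulAut G} (hφ : ∀ y, φ y * y⁻¹ ∈ commutator G) {n : ℕ}
    (hn : n ≠ 0) {g : G} (hg : φ g = g) (hpow : φ ^ n = MulAut.conj g) (N : ℕ) :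
    ∃ h : MonoidAlgebra ℚ G, h - 1 ∈ augFilt G 1 ∧
      ∀ a, ringAut φ a * h - h * a ∈ augFilt G N := by
  refine exists_approx_conj mul_mem_augFilt rfl augFilt_antitone (ringAut φ)
    (ringAut_sub_mem_augFilt hφ) hn (u := MonoidAlgebra.single g 1)
    (v := MonoidAlgebra.single g⁻¹ 1) ?_ (single_sub_one_mem_augFilt_one g) ?_ (fun a => ?_) N
  · rw [MonoidAlgebra.single_mul_single, inv_mul_cancel, mul_one, MonoidAlgebra.one_def]
  · rw [ringAut_single, hg]
  · have hit : ∀ (m : ℕ) (y : G) (r : ℚ), (ringAut φ)^[m] (MonoidAlgebra.single y r) =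
        MonoidAlgebra.single ((φ ^ m) y) r := by
      intro m y r
      induction m with
      | zero => rfl
      | succ m ih => rw [Function.iterate_succ_apply', ih, ringAut_single, pow_succ']; rfl
    have hlin : ∀ m : ℕ, (ringAut φ)^[m] = ((ringAut φ).toLinearMap ^ m : Module.End ℚ _) := by
      intro m
      rw [Module.End.coe_pow]; rfl
    induction a using MonoidAlgebra.induction_on with
    | of y =>
      rw [MonoidAlgebra.of_apply, hit, hpow, MulAut.conj_apply, MonoidAlgebra.single_mul_single,
        MonoidAlgebra.single_mul_single, mul_one, mul_one]
    | add a b ha hb =>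
      rw [hlin] at ha hb ⊢
      rw [map_add, ha, hb, mul_add, add_mul]
    | smul r a ha =>
      rw [hlin] at ha ⊢
      rw [map_smul, ha, mul_smul_comm, smul_mul_assoc]

end GroupRing

section Magnus

open PowerSeries

variable {V : Type*} (Γ : SimpleGraph V)

/-- The linear extension of the Magnus representation to the group ring. -/
noncomputable def magnusAlg : MonoidAlgebra ℚ (RAAG Γ) →ₐ[ℚ] (TraceAlg Γ)⟦X⟧ :=
  MonoidAlgebra.lift ℚ _ _ ((Units.coeHom _).comp (magnus Γ))

theorem magnusAlg_single (x : RAAG Γ) :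
    magnusAlg Γ (MonoidAlgebra.single x 1) = (magnus Γ x : (TraceAlg Γ)⟦X⟧) := by
  simp [magnusAlg, MonoidAlgebra.lift_single]

theorem coeff_magnusAlg_of_mem_augFilt {N : ℕ} {a : MonoidAlgebra ℚ (RAAG Γ)}
    (ha : a ∈ augFilt (RAAG Γ) N) : ∀ i < N, coeff i (magnusAlg Γ a) = 0 := by
  have h1 : ∀ x ∈ augIdeal (RAAG Γ), coeff 0 (magnusAlg Γ x) = 0 := by
    intro x hx
    induction hx using Submodule.span_induction with
    | mem x hx =>
      obtain ⟨y, rfl⟩ := hx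
      rw [map_sub, map_one, magnusAlg_single, map_sub, coeff_zero_eq_constantCoeff_apply,
        constantCoeff_magnus, coeff_zero_one, sub_self]
    | zero => simp
    | add a b _ _ ha hb => rw [map_add, map_add, ha, hb, add_zero]
    | smul r a _ ha => rw [map_smul, coeff_smul, ha, smul_zero]
  induction N generalizing a with
  | zero => simp
  | succ N ih =>
    refine Submodule.mul_induction_on ha (fun x hx b hb i hi => ?_) fun x y hx hy i hi => ?_
    · rw [map_mul, coeff_mul]
      refine Finset.sum_eq_zero fun p hp => ?_
      have := Finset.HasAntidiagonal.mem_antidiagonal.1 hp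
      rcases Nat.eq_zero_or_pos p.1 with h0 | h0
      · rw [h0, h1 x hx, zero_mul]
      · rw [ih hb p.2 (by omega), mul_zero]
    · rw [map_add, map_add, hx i hi, hy i hi, add_zero]

/-- A unipotent automorphism of a RAAG with a power conjugation by a fixed element is, to any
order in the Magnus representation, conjugation by a unit. -/
theorem exists_approx_conj_magnus {φ : MulAut (RAAG Γ)}
    (hφ : ∀ y, φ y * y⁻¹ ∈ commutator (RAAG Γ)) {n : ℕ} (hn : n ≠ 0) {g : RAAG Γ} (hg : φ g = g)
    (hpow : φ ^ n = MulAut.conj g) (N : ℕ) :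
    ∃ U : ((TraceAlg Γ)⟦X⟧)ˣ, constantCoeff (U : (TraceAlg Γ)⟦X⟧) = 1 ∧ ∀ y, EqMod N
      ((U : (TraceAlg Γ)⟦X⟧) * (magnus Γ y : (TraceAlg Γ)⟦X⟧))
      ((magnus Γ (φ y) : (TraceAlg Γ)⟦X⟧) * (U : (TraceAlg Γ)⟦X⟧)) := by
  obtain ⟨h, h1, hN⟩ := exists_approx_conj_groupRing hφ hn hg hpow N
  have hc : constantCoeff (magnusAlg Γ h) = 1 := by
    have := coeff_magnusAlg_of_mem_augFilt Γ h1 0 Nat.one_pos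
    rw [map_sub, map_one, map_sub, coeff_zero_one, sub_eq_zero] at this
    rwa [← coeff_zero_eq_constantCoeff_apply]
  refine ⟨unitOfConstOne _ hc, hc, fun y i hi => ?_⟩
  have := coeff_magnusAlg_of_mem_augFilt Γ (hN (MonoidAlgebra.single y 1)) i hi
  rw [ringAut_single, map_sub, map_mul, map_mul, magnusAlg_single, magnusAlg_single, map_sub,
    sub_eq_zero] at this
  exact this.symm

end Magnus

end RaagOut

namespace RaagOut

open PowerSeries

section Inner

variable {V : Type*} (Γ : SimpleGraph V)

variable {Γ} in
theorem raagGen_mem_center {x : V} (h : ∀ y, y = x ∨ Γ.Adj x y) :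
    raagGen Γ x ∈ Subgroup.center (RAAG Γ) := by
  refine Subgroup.mem_center_iff.2 fun y => ?_
  have hy : y ∈ Subgroup.centralizer {raagGen Γ x} := by
    refine raag_mem_of_gen (fun y => Subgroup.mem_centralizer_singleton_iff.2 ?_) y
    rcases h y with rfl | h
    · rfl
    · exact (raagGen_commute Γ h).symm.eq
  exact Subgroup.mem_centralizer_singleton_iff.1 hy

theorem map_mem_commutator_eq_one {G A : Type*} [Group G] [CommGroup A] (f : G →* A) {c : G}
    (hc : c ∈ commutator G) : f c = 1 :=
  Abelianization.commutator_subset_ker f hc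

theorem raagRetract_star_of_mem_center {z : RAAG Γ} (hz : z ∈ Subgroup.center (RAAG Γ)) (v : V) :
    raagRetract Γ (star Γ v) z = z := by
  refine magnus_injective Γ (Units.ext ?_)
  rw [← map_algRetract_magnus]
  refine eq_of_forall_eqMod fun N => map_algRetract_star_of_eqMod Γ (v := v) fun i _ => ?_
  rw [← Units.val_mul, ← Units.val_mul, ← map_mul, ← map_mul, Subgroup.mem_center_iff.1 hz]

variable {Γ} {v w : V}

theorem raagRetract_raagRetract_mem_center
    (hvw : ∀ x ∈ star Γ v, x ∈ star Γ w → ∀ y, y = x ∨ Γ.Adj x y)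
    (x : RAAG Γ) :
    raagRetract Γ (star Γ v) (raagRetract Γ (star Γ w) x) ∈ Subgroup.center (RAAG Γ) := by
  classical
  refine raag_mem_of_gen (H := (Subgroup.center (RAAG Γ)).comap
    ((raagRetract Γ (star Γ v)).comp (raagRetract Γ (star Γ w)))) (fun y => ?_) x
  rw [Subgroup.mem_comap, MonoidHom.comp_apply, raagRetract_gen]
  by_cases hw : y ∈ star Γ w
  · rw [if_pos hw, raagRetract_gen]
    by_cases hv : y ∈ star Γ v
    · rw [if_pos hv]
      exact raagGen_mem_center (hvw y hv hw)
    · rw [if_neg hv]; exact one_mem _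
  · rw [if_neg hw, map_one]; exact one_mem _

theorem eq_one_of_mem_center_of_mem_commutator
    (hvw : ∀ x ∈ star Γ v, x ∈ star Γ w → ∀ y, y = x ∨ Γ.Adj x y) {z : RAAG Γ}
    (hz : z ∈ Subgroup.center (RAAG Γ)) (hz' : z ∈ commutator (RAAG Γ)) : z = 1 := by
  let f : RAAG Γ →* RAAG Γ := (raagRetract Γ (star Γ v)).comp (raagRetract Γ (star Γ w))
  have hf : commutator (RAAG Γ) ≤ f.ker := by
    rw [commutator_def, Subgroup.commutator_le]
    intro a _ b _
    have := (Subgroup.mem_center_iff.1 (raagRetract_raagRetract_mem_center hvw a)) (f b)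
    rw [MonoidHom.mem_ker, map_commutatorElement, commutatorElement_eq_one_iff_mul_comm]
    exact this.symm
  have := hf hz'
  rw [MonoidHom.mem_ker, MonoidHom.comp_apply, raagRetract_star_of_mem_center Γ hz,
    raagRetract_star_of_mem_center Γ hz] at this
  exact this

theorem apply_eq_self_of_pow_eq_conj
    (hvw : ∀ x ∈ star Γ v, x ∈ star Γ w → ∀ y, y = x ∨ Γ.Adj x y) {φ : MulAut (RAAG Γ)}
    (hφ : ∀ y, φ y * y⁻¹ ∈ commutator (RAAG Γ)) {n : ℕ} {g : RAAG Γ}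
    (hpow : φ ^ n = MulAut.conj g) : φ g = g := by
  refine mul_inv_eq_one.1 (eq_one_of_mem_center_of_mem_commutator hvw ?_ (hφ g))
  have h : ∀ y, φ g * y * (φ g)⁻¹ = g * y * g⁻¹ := by
    intro y
    have e : φ ((φ ^ n) (φ⁻¹ y)) = (φ ^ n) y := by
      rw [← MulAut.mul_apply, ← MulAut.mul_apply, ← pow_succ', pow_succ, mul_assoc, mul_inv_cancel,
        mul_one]
    rwa [hpow, MulAut.conj_apply, MulAut.conj_apply, map_mul, map_mul, map_inv,
      MulAut.apply_inv_self] at e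
  refine Subgroup.mem_center_iff.2 fun y => ?_
  calc y * (φ g * g⁻¹) = g * (g⁻¹ * y * g) * g⁻¹ * (φ g * g⁻¹) := by group
    _ = φ g * (g⁻¹ * y * g) * (φ g)⁻¹ * (φ g * g⁻¹) := by rw [h]
    _ = φ g * g⁻¹ * y := by group

/-- A unipotent automorphism which is of finite order up to inner automorphisms is inner. -/
theorem exists_eq_conj
    (hvw : ∀ x ∈ star Γ v, x ∈ star Γ w → ∀ y, y = x ∨ Γ.Adj x y) {φ : MulAut (RAAG Γ)}
    (hφ : ∀ y, φ y * y⁻¹ ∈ commutator (RAAG Γ)) {n : ℕ} (hn : n ≠ 0) {g : RAAG Γ}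
    (hpow : φ ^ n = MulAut.conj g) : ∃ k, φ = MulAut.conj k := by
  have happ := exists_approx_conj_magnus Γ hφ hn (apply_eq_self_of_pow_eq_conj hvw hφ hpow) hpow
  have hconj : ∀ u : V, ∃ k, k * raagGen Γ u * k⁻¹ = φ (raagGen Γ u) := by
    intro u
    refine isConj_iff.1 (isConj_gen_of_eqMod Γ (fun f => ?_) fun N => ?_)
    · exact mul_inv_eq_one.1 (by rw [← map_inv, ← map_mul, map_mem_commutator_eq_one f (hφ _)])
    · obtain ⟨U, -, hU⟩ := happ N
      exact ⟨U, hU _⟩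
  have hret : ∀ {N : ℕ} {U : ((TraceAlg Γ)⟦X⟧)ˣ} {u : V} {k : RAAG Γ},
      k * raagGen Γ u * k⁻¹ = φ (raagGen Γ u) →
      EqMod (N + 1) ((U : (TraceAlg Γ)⟦X⟧) * (magnus Γ (raagGen Γ u) : (TraceAlg Γ)⟦X⟧))
        ((magnus Γ (φ (raagGen Γ u)) : (TraceAlg Γ)⟦X⟧) * (U : (TraceAlg Γ)⟦X⟧)) →
      EqMod N (PowerSeries.map (algRetract Γ (star Γ u) : TraceAlg Γ →+* TraceAlg Γ)
        ((magnus Γ k⁻¹ * U : ((TraceAlg Γ)⟦X⟧)ˣ) : (TraceAlg Γ)⟦X⟧))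
        ((magnus Γ k⁻¹ * U : ((TraceAlg Γ)⟦X⟧)ˣ) : (TraceAlg Γ)⟦X⟧) := by
    intro N U u k hk hU
    refine map_algRetract_star_of_eqMod Γ (v := u) ?_
    have := (EqMod.refl _ (magnus Γ k⁻¹ : (TraceAlg Γ)⟦X⟧)).mul hU
    rw [← hk, ← mul_assoc, ← mul_assoc, ← Units.val_mul (magnus Γ k⁻¹) (magnus Γ _), ← map_mul,
      mul_assoc k, inv_mul_cancel_left, map_mul, Units.val_mul] at this
    rw [Units.val_mul, ← mul_assoc]
    exact this.symm
  obtain ⟨kv, hkv⟩ := hconj v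
  obtain ⟨kw, hkw⟩ := hconj w
  set K := kv * raagRetract Γ (star Γ v) (kv⁻¹ * kw) with hK
  have hgen : ∀ y, K * raagGen Γ y = φ (raagGen Γ y) * K := by
    intro y
    refine magnus_injective Γ (Units.ext (eq_of_forall_eqMod fun N => ?_))
    obtain ⟨U, hU1, hU⟩ := happ (N + 1)
    set ρv := PowerSeries.map (algRetract Γ (star Γ v) : TraceAlg Γ →+* TraceAlg Γ) with hρv
    set ρw := PowerSeries.map (algRetract Γ (star Γ w) : TraceAlg Γ →+* TraceAlg Γ) with hρw
    have hv := hret hkv (hU _)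
    have hw := hret hkw (hU _)
    set c := magnus Γ kw⁻¹ * U with hc
    have hz1 : constantCoeff (ρv (ρw c)) = 1 := by
      rw [hc, Units.val_mul, hρv, hρw, ← coeff_zero_eq_constantCoeff_apply, coeff_map, coeff_map,
        coeff_zero_eq_constantCoeff_apply, map_mul, constantCoeff_magnus, hU1, one_mul, map_one,
        map_one]
    set z := unitOfConstOne _ hz1 with hz
    have hzy : Commute (z : (TraceAlg Γ)⟦X⟧) (magnus Γ (raagGen Γ y) : (TraceAlg Γ)⟦X⟧) := by
      rw [magnus_gen]
      refine oneAddUnit_commute_of_coeff fun i => ?_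
      exact algRetract_algRetract_commute Γ (fun x hx hx' => hvw x hx hx' y) _
    have hUK : EqMod N (U : (TraceAlg Γ)⟦X⟧)
        ((magnus Γ K : (TraceAlg Γ)⟦X⟧) * (z : (TraceAlg Γ)⟦X⟧)) := by
      have e : magnus Γ kv⁻¹ * U = magnus Γ (kv⁻¹ * kw) * c := by
        rw [hc, ← mul_assoc, ← map_mul, mul_inv_cancel_right]
      have h₁ : EqMod N (ρv ((magnus Γ kv⁻¹ * U : ((TraceAlg Γ)⟦X⟧)ˣ) : (TraceAlg Γ)⟦X⟧))
          ((magnus Γ (raagRetract Γ (star Γ v) (kv⁻¹ * kw)) : (TraceAlg Γ)⟦X⟧) *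
            (z : (TraceAlg Γ)⟦X⟧)) := by
        rw [e, Units.val_mul, map_mul, hρv, map_algRetract_magnus]
        exact (EqMod.refl _ _).mul (hw.symm.map _)
      have h₂ := (EqMod.refl _ (magnus Γ kv : (TraceAlg Γ)⟦X⟧)).mul (hv.symm.trans h₁)
      rw [← Units.val_mul, ← mul_assoc, ← map_mul, mul_inv_cancel, map_one, one_mul, ← mul_assoc,
        ← Units.val_mul, ← map_mul, ← hK] at h₂
      exact h₂
    refine EqMod.mul_right_cancel (U := z) ?_
    have h₃ := ((hUK.symm.mul (EqMod.refl _ _)).trans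
      ((hU (raagGen Γ y)).mono (Nat.le_succ N))).trans ((EqMod.refl _ _).mul hUK)
    rw [mul_assoc, hzy.eq, ← mul_assoc, ← mul_assoc] at h₃
    simpa only [map_mul, Units.val_mul] using h₃
  refine ⟨K, ?_⟩
  have h : (φ : RAAG Γ →* RAAG Γ) = (MulAut.conj K : MulAut (RAAG Γ)) :=
    raag_hom_ext fun y => eq_mul_inv_of_mul_eq (hgen y).symm
  exact MulEquiv.ext fun y => DFunLike.congr_fun h y

end Inner

end RaagOut

namespace RaagOut

section Tree

variable {V : Type*}

/-- In a tree there are two vertices such that every common element of their stars is adjacent to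
all other vertices. -/
theorem exists_star_inter_central {Γ : SimpleGraph V} (hΓ : Γ.IsTree) :
    ∃ v w, ∀ x ∈ star Γ v, x ∈ star Γ w → ∀ y, y = x ∨ Γ.Adj x y := by
  by_cases hdisj : ∃ v w, ∀ x ∈ star Γ v, x ∉ star Γ w
  · obtain ⟨v, w, h⟩ := hdisj
    exact ⟨v, w, fun x hx hx' => absurd hx' (h x hx)⟩
  push Not at hdisj
  by_cases hadj : ∃ v w, v ≠ w ∧ ¬ Γ.Adj v w
  · obtain ⟨v, w, hne, hvw⟩ := hadj
    refine ⟨v, w, fun x hxv hxw y => ?_⟩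
    by_contra hy
    push Not at hy
    obtain ⟨hyx, hxy⟩ := hy
    have hvx : Γ.Adj v x := hxv.resolve_left fun e =>
      hxw.elim (fun e' => hne (e.symm.trans e')) fun h => hvw (e ▸ h).symm
    have hwx : Γ.Adj w x := hxw.resolve_left fun e =>
      hxv.elim (fun e' => hne (e'.symm.trans e)) fun h => hvw (e ▸ h)
    have step {p q : V} (hp : p ≠ x) (hq : q ≠ x) (h : q ∈ star Γ p) :
        (Γ.deleteEdges {s(v, x)}).Reachable p q := by
      rcases h with rfl | h
      · exact SimpleGraph.Reachable.refl _
      · refine SimpleGraph.Adj.reachable (SimpleGraph.deleteEdges_adj.2 ⟨h, fun e => ?_⟩)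
        rw [Set.mem_singleton_iff, Sym2.eq_iff] at e
        exact e.elim (fun e => hq e.2) fun e => hp e.1
    have avoid {a : V} (ha : a ∈ star Γ y) : a ≠ x := by
      rintro rfl
      exact ha.elim (fun e => hyx e.symm) fun h => hxy h.symm
    obtain ⟨a, hay, hav⟩ := hdisj y v
    obtain ⟨b, hby, hbw⟩ := hdisj y w
    have hlast : (Γ.deleteEdges {s(v, x)}).Reachable w x := by
      refine SimpleGraph.Adj.reachable (SimpleGraph.deleteEdges_adj.2 ⟨hwx, fun e => ?_⟩)
      rw [Set.mem_singleton_iff, Sym2.eq_iff] at e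
      exact e.elim (fun e => hne e.1.symm) fun e => hwx.ne e.1
    have hbridge := SimpleGraph.isAcyclic_iff_forall_adj_isBridge.1 hΓ.isAcyclic hvx
    refine SimpleGraph.isBridge_iff.1 hbridge ?_
    exact (step hvx.ne (avoid hay) hav).trans <| (step hyx (avoid hay) hay).symm.trans <|
      (step hyx (avoid hby) hby).trans <| (step hwx.ne (avoid hby) hbw).symm.trans hlast
  · push Not at hadj
    obtain ⟨v⟩ := hΓ.connected.nonempty
    exact ⟨v, v, fun x _ _ y => or_iff_not_imp_left.2 fun h => hadj x y (Ne.symm h)⟩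

end Tree

end RaagOut

namespace RaagOut

section Congruence

theorem exists_eq_nsmul_of_forall_dvd {A : Type*} [AddGroup A] {m : ℕ} {h : A →+ ℤ}
    (hm : m ≠ 0) (hh : ∀ x, (m : ℤ) ∣ h x) : ∃ g : A →+ ℤ, h = m • g := by
  have hm' : (m : ℤ) ≠ 0 := Nat.cast_ne_zero.2 hm
  choose g hg using hh
  refine ⟨AddMonoidHom.mk' g fun x y => mul_left_cancel₀ hm' ?_, AddMonoidHom.ext fun x => ?_⟩
  · rw [mul_add, ← hg, ← hg, ← hg, map_add]
  · simp [hg x]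

/-- If `D` is divisible by `m` on `Hom(A, ℤ)`, it maps multiples of `n` to multiples of `n * m`. -/
theorem dvd_apply_of_forall_dvd {A : Type*} [AddGroup A] {m n : ℕ} {D : AddMonoid.End (A →+ ℤ)}
    (hn : n ≠ 0) (hD : ∀ f x, (m : ℤ) ∣ D f x) {f : A →+ ℤ} (hf : ∀ x, (n : ℤ) ∣ f x) (x : A) :
    ((n * m : ℕ) : ℤ) ∣ D f x := by
  obtain ⟨g, rfl⟩ := exists_eq_nsmul_of_forall_dvd hn hf
  rw [map_nsmul, AddMonoidHom.nsmul_apply, nsmul_eq_mul, Nat.cast_mul]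
  exact mul_dvd_mul_left _ (hD g x)

/-- An endomorphism of prime order of `Hom(A, ℤ)` that is trivial modulo `3` is trivial. -/
theorem eq_one_of_pow_prime_eq_one {A : Type*} [AddGroup A] {T : AddMonoid.End (A →+ ℤ)}
    (hT : ∀ f x, (3 : ℤ) ∣ T f x - f x) {p : ℕ} (hp : p.Prime) (hpow : T ^ p = 1) : T = 1 := by
  obtain ⟨D, rfl⟩ : ∃ D, T = 1 + D := ⟨T - 1, by abel⟩
  have hstep (k : ℕ) (hk : 1 ≤ k) (hD : ∀ f x, ((3 ^ k : ℕ) : ℤ) ∣ D f x) (f : A →+ ℤ) (x : A) :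
      ((3 ^ (k + 1) : ℕ) : ℤ) ∣ D f x := by
    have h₂ (f x) : ((3 ^ k * 3 ^ k : ℕ) : ℤ) ∣ D (D f) x :=
      dvd_apply_of_forall_dvd (by positivity) hD (hD f) x
    by_cases hp3 : p = 3
    · subst hp3
      have e : 3 • D + 3 • (D * D) + D * (D * D) = 0 := by
        have : (1 + D) ^ 3 = 1 + (3 • D + 3 • (D * D) + D * (D * D)) := by noncomm_ring
        rwa [this, add_eq_left] at hpow
      have h₃ : ((3 ^ k * 3 ^ k * 3 ^ k : ℕ) : ℤ) ∣ D (D (D f)) x :=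
        dvd_apply_of_forall_dvd (by positivity) hD (h₂ f) x
      have e' : 3 • D f x + 3 • D (D f) x + D (D (D f)) x = 0 :=
        DFunLike.congr_fun (DFunLike.congr_fun e f) x
      simp only [nsmul_eq_mul, Nat.cast_ofNat] at e'
      have hk₂ : ((3 * 3 ^ (k + 1) : ℕ) : ℤ) ∣ 3 * D (D f) x := by
        rw [Nat.cast_mul]
        refine mul_dvd_mul_left _ (dvd_trans ?_ (h₂ f x))
        rw [← pow_add]
        exact_mod_cast pow_dvd_pow 3 (by omega)
      have hk₃ : ((3 * 3 ^ (k + 1) : ℕ) : ℤ) ∣ D (D (D f)) x := by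
        refine dvd_trans ?_ h₃
        rw [← pow_add, ← pow_add, ← pow_succ']
        exact_mod_cast pow_dvd_pow 3 (by omega)
      have h := dvd_neg.2 (dvd_add hk₂ hk₃)
      rw [show -(3 * D (D f) x + D (D (D f)) x) = 3 * D f x by linarith, Nat.cast_mul] at h
      exact Int.dvd_of_mul_dvd_mul_left (by norm_num) h
    · obtain ⟨K, hK⟩ := Polynomial.powAddExpansion 1 (Polynomial.X : Polynomial ℤ) p
      have e := congrArg (Polynomial.aeval D) hK
      simp only [map_add, map_mul, map_pow, map_one, map_nsmul, Polynomial.aeval_X, one_pow,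
        mul_one, hpow, add_assoc, left_eq_add, pow_two,
        ← nsmul_eq_mul] at e
      have e' : p • D f x + Polynomial.aeval D K (D (D f)) x = 0 :=
        DFunLike.congr_fun (DFunLike.congr_fun e f) x
      rw [nsmul_eq_mul] at e'
      have hK' : ((3 ^ k * 3 ^ k : ℕ) : ℤ) ∣ Polynomial.aeval D K (D (D f)) x := by
        simpa using dvd_apply_of_forall_dvd (m := 1) (D := Polynomial.aeval D K)
          (by positivity) (fun f x => by simp) (h₂ f) x
      have hk : ((3 ^ (k + 1) : ℕ) : ℤ) ∣ p * D f x := by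
        rw [eq_neg_of_add_eq_zero_left e', dvd_neg, ← pow_add] at *
        refine dvd_trans ?_ hK'
        exact_mod_cast pow_dvd_pow 3 (by omega)
      refine IsCoprime.dvd_of_dvd_mul_left (Nat.isCoprime_iff_coprime.2 ?_) hk
      exact Nat.Coprime.pow_left _ ((Nat.coprime_primes Nat.prime_three hp).2 (Ne.symm hp3))
  have hall (k : ℕ) : ∀ f x, ((3 ^ (k + 1) : ℕ) : ℤ) ∣ D f x := by
    induction k with
    | zero =>
      intro f x
      simpa [sub_eq_iff_eq_add'.2 (show (1 + D) f x = f x + D f x from rfl)] using hT f x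
    | succ k ih => exact hstep _ (by omega) ih
  rw [add_eq_left]
  refine AddMonoidHom.ext fun f => AddMonoidHom.ext fun x => ?_
  refine Int.eq_zero_of_abs_lt_dvd (hall (D f x).natAbs f x) ?_
  rw [Int.abs_eq_natAbs]
  exact_mod_cast (Nat.lt_pow_self (by norm_num)).trans (Nat.pow_lt_pow_succ (by norm_num))

end Congruence

section Level

variable {V : Type*} (Γ : SimpleGraph V)

/-- The action of automorphisms on the homomorphisms to a fixed group. -/
def homPerm (G A : Type*) [Group G] [Group A] : MulAut G →* Equiv.Perm (G →* A) where
  toFun φ := φ.monoidHomCongrLeftEquiv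
  map_one' := rfl
  map_mul' _ _ := rfl

theorem homPerm_apply {G A : Type*} [Group G] [Group A] (φ : MulAut G) (f : G →* A) (x : G) :
    homPerm G A φ f x = f (φ⁻¹ x) := rfl

theorem homPerm_eq_one_iff {G A : Type*} [Group G] [Group A] {φ : MulAut G} :
    homPerm G A φ = 1 ↔ ∀ f : G →* A, ∀ x, f (φ x) = f x := by
  refine ⟨fun h f x => ?_, fun h => Equiv.ext fun f => MonoidHom.ext fun x => ?_⟩
  · have h' := homPerm_apply φ f (φ x)
    rw [h, MulAut.inv_apply_self] at h'
    exact h'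
  · rw [homPerm_apply, ← h, MulAut.apply_inv_self, Equiv.Perm.one_apply]

/-- The action of outer automorphisms on the homomorphisms to an abelian group. -/
def outHomPerm (G A : Type*) [Group G] [CommGroup A] : OutG G →* Equiv.Perm (G →* A) :=
  QuotientGroup.lift _ (homPerm G A) (by
    rintro _ ⟨g, rfl⟩
    exact homPerm_eq_one_iff.2 fun f x => by simp)

/-- An element of a right-angled Artin group killed by all homomorphisms to `ℤ` is a product of
commutators. -/
theorem mem_commutator_of_forall_hom [Fintype V] {x : RAAG Γ}
    (hx : ∀ f : RAAG Γ →* Multiplicative ℤ, f x = 1) : x ∈ commutator (RAAG Γ) := by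
  classical
  let coord (v : V) : RAAG Γ →* Multiplicative ℤ :=
    raagLift Γ (fun w => if w = v then Multiplicative.ofAdd 1 else 1) fun _ _ _ => Commute.all _ _
  have h : (Abelianization.of : RAAG Γ →* Abelianization (RAAG Γ)) =
      ∏ v, (zpowersHom _ (Abelianization.of (raagGen Γ v))).comp (coord v) := by
    refine raag_hom_ext fun w => ?_
    rw [MonoidHom.finsetProd_apply, Finset.prod_eq_single w]
    · simp [coord, raagLift_gen]
    · intro v _ hv
      simp [coord, raagLift_gen, hv.symm]
    · simp
  rw [← Abelianization.ker_of, MonoidHom.mem_ker, h, MonoidHom.finsetProd_apply]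
  exact Finset.prod_eq_one fun v _ => by simp [hx]

/-- An automorphism with an inner prime power which is trivial modulo `3` on the abelianization
acts trivially on the homomorphisms to `ℤ`. -/
theorem hom_int_apply_eq {G : Type*} [Group G] {φ : MulAut G}
    (hφ : homPerm G (Multiplicative (ZMod 3)) φ = 1) {p : ℕ} (hp : p.Prime) {g : G}
    (hpow : φ ^ p = MulAut.conj g) (f : G →* Multiplicative ℤ) (x : G) : f (φ x) = f x := by
  let T (ψ : MulAut G) : AddMonoid.End (Additive G →+ ℤ) :=
    AddMonoidHom.compHom' (MonoidHom.toAdditive (ψ : G →* G))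
  have hT (n : ℕ) : T φ ^ n = T (φ ^ n) := by
    induction n with
    | zero => rfl
    | succ n ih => rw [pow_succ, ih, pow_succ']; rfl
  have hTp : T φ ^ p = 1 := by
    rw [hT, hpow]
    refine AddMonoidHom.ext fun f => AddMonoidHom.ext fun x => ?_
    change f (Additive.ofMul g + x + -Additive.ofMul g) = f x
    simp
  have h := eq_one_of_pow_prime_eq_one (T := T φ) (fun f x => ?_) hp hTp
  · exact DFunLike.congr_fun (DFunLike.congr_fun h (MonoidHom.toAdditiveLeft f)) (Additive.ofMul x)
  · have h₃ := homPerm_eq_one_iff.1 hφ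
      (AddMonoidHom.toMultiplicativeRight ((Int.castAddHom (ZMod 3)).comp f)) x.toMul
    refine (ZMod.intCast_zmod_eq_zero_iff_dvd _ 3).1 ?_
    rw [Int.cast_sub, sub_eq_zero]
    exact h₃

/-- For a finite tree, an outer automorphism of prime order acts nontrivially modulo `3`. -/
theorem eq_one_of_outHomPerm_eq_one [Fintype V] (hΓ : Γ.IsTree) {x : OutG (RAAG Γ)}
    (hx : outHomPerm (RAAG Γ) (Multiplicative (ZMod 3)) x = 1) {p : ℕ} (hp : p.Prime)
    (hpow : x ^ p = 1) : x = 1 := by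
  obtain ⟨φ, rfl⟩ := QuotientGroup.mk_surjective x
  obtain ⟨g, hg⟩ := (QuotientGroup.eq_one_iff (φ ^ p)).1 hpow
  obtain ⟨v, w, hvw⟩ := exists_star_inter_central hΓ
  have hφ (y : RAAG Γ) : φ y * y⁻¹ ∈ commutator (RAAG Γ) :=
    mem_commutator_of_forall_hom Γ fun f => by
      rw [map_mul, map_inv, hom_int_apply_eq hx hp hg.symm, mul_inv_cancel]
  obtain ⟨k, hk⟩ := exists_eq_conj hvw hφ hp.ne_zero hg.symm
  exact (QuotientGroup.eq_one_iff φ).2 ⟨k, hk.symm⟩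

end Level

end RaagOut

/-- Let `Γ` be a finite tree.  Then `Out⁰(A_Γ)` is virtually
torsion-free: it has a torsion-free subgroup of finite index. -/
theorem outzero_virtually_torsion_free
    {V : Type*} [Fintype V] (Γ : SimpleGraph V) (hΓ : Γ.IsTree) :
    ∃ H : Subgroup (OutZero Γ), H.FiniteIndex ∧
      ∀ g ∈ H, g ≠ 1 → ¬ IsOfFinOrder g := by
  have : Finite (RAAG Γ →* Multiplicative (ZMod 3)) :=
    Finite.of_injective (fun f v => f (raagGen Γ v)) fun f g h =>
      RaagOut.raag_hom_ext (congrFun h)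
  let θ := (RaagOut.outHomPerm (RAAG Γ) (Multiplicative (ZMod 3))).comp (OutZero Γ).subtype
  refine ⟨θ.ker, inferInstance, fun x hx hne hfin => ?_⟩
  have horder : orderOf x ≠ 1 := orderOf_eq_one_iff.not.2 hne
  have hprime := Nat.minFac_prime horder
  have hord := orderOf_pow_orderOf_div hfin.orderOf_pos.ne' (Nat.minFac_dvd (orderOf x))
  set y := x ^ (orderOf x / (orderOf x).minFac)
  have hy : (y : OutG (RAAG Γ)) = 1 := by
    refine RaagOut.eq_one_of_outHomPerm_eq_one Γ hΓ (θ.ker.pow_mem hx _) hprime ?_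
    rw [← Subgroup.coe_pow, ← hord, pow_orderOf_eq_one, Subgroup.coe_one]
  rw [orderOf_eq_one_iff.2 (Subtype.ext hy : y = 1)] at hord
  exact hprime.ne_one hord.symm
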